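/- Let f, h be real Schwartz functions on ℝ³, fix t₀ > 0, set ψ = K_{t₀}(f,h), and define u(t,x⃗) = (2π)^{−3/2}·∫_{ℝ³} e^{i k⃗·x⃗}·[v(t,|k⃗|)·ψ(k⃗) + conj(v(t,|k⃗|))·conj(ψ(−k⃗))] dk⃗. Then u solves the de Sitter Klein–Gordon equation (t²/R²)·(∂²u/∂t² − Δu) − (2t/R²)·∂u/∂t + m²·u = 0 on (0,∞)×ℝ³, and u attains the Cauchy data u(t₀,·) = f and (t₀/R)·∂u/∂t(t₀,·) = h. -/

import Mathlib

open Complex MeasureTheory Filter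
open scoped RealInnerProductSpace

noncomputable section

/-- Three-dimensional Euclidean space. -/
abbrev V3 : Type := EuclideanSpace ℝ (Fin 3)

/-- The Bessel function of complex order `α`:
`J_α(x) = Σ_{n=0}^∞ ((−1)^n/(n!·Γ(α+n+1)))·exp((α+2n)·log(x/2))`. -/
def besselJ (α : ℂ) (x : ℝ) : ℂ :=
  ∑' n : ℕ, ((-1 : ℂ) ^ n / ((n.factorial : ℂ) * Complex.Gamma (α + (n : ℂ) + 1))) *
    Complex.exp ((α + 2 * (n : ℂ)) * (Real.log (x / 2) : ℂ))

/-- The Hankel function of the first kind. -/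
def hankel1 (α : ℂ) (x : ℝ) : ℂ :=
  (besselJ (-α) x - Complex.exp (-(Complex.I * (Real.pi : ℂ) * α)) * besselJ α x) /
    (Complex.I * Complex.sin (α * (Real.pi : ℂ)))

/-- The Hankel function of the second kind. -/
def hankel2 (α : ℂ) (x : ℝ) : ℂ :=
  (Complex.exp (Complex.I * (Real.pi : ℂ) * α) * besselJ α x - besselJ (-α) x) /
    (Complex.I * Complex.sin (α * (Real.pi : ℂ)))

/-- `μ = √((mR)² − 9/4)`. -/
def modeMu (m R : ℝ) : ℝ := Real.sqrt ((m * R) ^ 2 - 9 / 4)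

/-- `ν = iμ`. -/
def modeNu (m R : ℝ) : ℂ := Complex.I * (modeMu m R : ℂ)

/-- The mode function `v(t,k) = e^{−μπ/2}·t^{3/2}·H^{(1)}_ν(kt)`. -/
def modeV (m R t k : ℝ) : ℂ :=
  (Real.exp (-(modeMu m R * Real.pi / 2)) : ℂ) * ((t ^ ((3 : ℝ) / 2) : ℝ) : ℂ) *
    hankel1 (modeNu m R) (k * t)

/-- `v′(t,k) = ∂v/∂t (t,k)`. -/
def modeV' (m R t k : ℝ) : ℂ := deriv (fun s => modeV m R s k) t

/-- `ω(k) = √(1+k²)`. -/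
def omegaK (k : ℝ) : ℝ := Real.sqrt (1 + k ^ 2)

/-- The Fourier transform on `ℝ³`. -/
def ft (g : V3 → ℂ) (k : V3) : ℂ :=
  (((2 * Real.pi) ^ (-(3 : ℝ) / 2) : ℝ) : ℂ) *
    ∫ x : V3, Complex.exp (-(Complex.I) * (⟪k, x⟫ : ℂ)) * g x

/-- The inverse Fourier transform on `ℝ³`. -/
def ift (g : V3 → ℂ) (x : V3) : ℂ :=
  (((2 * Real.pi) ^ (-(3 : ℝ) / 2) : ℝ) : ℂ) *
    ∫ k : V3, Complex.exp (Complex.I * (⟪k, x⟫ : ℂ)) * g k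

/-- The map `K_t` on the Fourier side, applied to the Fourier transforms `f̃, h̃`
of the Cauchy data:
`K_t(f,h)(k) = (πi/(4t³))·[t·f̃(k)·conj(v′(t,|k|)) − R·h̃(k)·conj(v(t,|k|))]`. -/
def ktAux (m R t : ℝ) (ftil htil : V3 → ℂ) (k : V3) : ℂ :=
  ((Real.pi : ℂ) * Complex.I / (4 * (t : ℂ) ^ 3)) *
    ((t : ℂ) * ftil k * (starRingEnd ℂ) (modeV' m R t ‖k‖) -
      (R : ℂ) * htil k * (starRingEnd ℂ) (modeV m R t ‖k‖))

/-- `K_t` applied to real Cauchy data `(f,h)`. -/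
def ktFun (m R t : ℝ) (f h : V3 → ℝ) : V3 → ℂ :=
  ktAux m R t (ft fun x => (f x : ℂ)) (ft fun x => (h x : ℂ))

/-- The Fourier transform of the first component of the pair `L_tψ`:
`f̃_t(k) = v(t,|k|)·ψ(k) + conj(v(t,|k|))·conj(ψ(−k))`. -/
def ltF (m R t : ℝ) (ψ : V3 → ℂ) (k : V3) : ℂ :=
  modeV m R t ‖k‖ * ψ k + (starRingEnd ℂ) (modeV m R t ‖k‖) * (starRingEnd ℂ) (ψ (-k))

/-- The Fourier transform of the second component of the pair `L_tψ`:
`h̃_t(k) = (t/R)·[v′(t,|k|)·ψ(k) + conj(v′(t,|k|))·conj(ψ(−k))]`. -/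
def ltH (m R t : ℝ) (ψ : V3 → ℂ) (k : V3) : ℂ :=
  ((t / R : ℝ) : ℂ) *
    (modeV' m R t ‖k‖ * ψ k + (starRingEnd ℂ) (modeV' m R t ‖k‖) * (starRingEnd ℂ) (ψ (-k)))

/-- The solution `u(t,x⃗)` built from the coefficient function `ψ`:
`u(t,x⃗) = (2π)^{−3/2}·∫ e^{ik⃗·x⃗}·[v(t,|k⃗|)·ψ(k⃗) + conj(v(t,|k⃗|))·conj(ψ(−k⃗))] dk⃗`. -/
def uSol (m R : ℝ) (ψ : V3 → ℂ) (t : ℝ) (x : V3) : ℂ :=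
  (((2 * Real.pi) ^ (-(3 : ℝ) / 2) : ℝ) : ℂ) *
    ∫ k : V3, Complex.exp (Complex.I * (⟪k, x⟫ : ℂ)) *
      (modeV m R t ‖k‖ * ψ k + (starRingEnd ℂ) (modeV m R t ‖k‖) * (starRingEnd ℂ) (ψ (-k)))

/-- The spatial Laplacian, as the sum of the second partial derivatives along
the coordinate directions. -/
def lap3 (w : V3 → ℂ) (x : V3) : ℂ :=
  ∑ i : Fin 3, iteratedDeriv 2 (fun s : ℝ => w (x + s • EuclideanSpace.single i (1 : ℝ))) 0

/-- The square of the Sobolev-type norm `‖(f,h)‖_{1/2}`, expressed in terms of the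
Fourier transforms `f̃, h̃` of the data:
`‖(f,h)‖_{1/2}² = ∫ ω(|k⃗|)·|f̃(k⃗)|² dk⃗ + ∫ ω(|k⃗|)⁻¹·|h̃(k⃗)|² dk⃗`. -/
def halfNormSq (ftil htil : V3 → ℂ) : ℝ :=
  (∫ k : V3, omegaK ‖k‖ * ‖ftil k‖ ^ 2) + ∫ k : V3, (omegaK ‖k‖)⁻¹ * ‖htil k‖ ^ 2

/-- The Sobolev-type norm `‖(f,h)‖_{1/2}` (arguments are the Fourier transforms). -/
def halfNorm (ftil htil : V3 → ℂ) : ℝ := Real.sqrt (halfNormSq ftil htil)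

/-- The `L²(ℝ³)` norm. -/
def l2Norm (g : V3 → ℂ) : ℝ := Real.sqrt (∫ k : V3, ‖g k‖ ^ 2)

/-- The transformed potential operator `V̂` with (Fourier-transformed) potential `W`:
`(V̂ψ)(k⃗) = −(2π)^{3/2}·R·(πi/4)·conj(v(1,|k⃗|))·(W ∗ g_ψ)(k⃗)` where
`g_ψ(k⃗) = v(1,|k⃗|)·ψ(k⃗) + conj(v(1,|k⃗|))·conj(ψ(−k⃗))`. -/
def vHatOp (m R : ℝ) (W : V3 → ℂ) (ψ : V3 → ℂ) (k : V3) : ℂ :=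
  ((-((2 * Real.pi) ^ ((3 : ℝ) / 2)) * R : ℝ) : ℂ) * ((Real.pi : ℂ) * Complex.I / 4) *
    (starRingEnd ℂ) (modeV m R 1 ‖k‖) * ∫ y : V3, W y * ltF m R 1 ψ (k - y)

/-- The free transformed evolution `Û₀(a,b) = K₁ ∘ L_a ∘ K_b ∘ L₁` on `L²(ℝ³)`. -/
def u0Hat (m R a b : ℝ) (ψ : V3 → ℂ) : V3 → ℂ :=
  ktAux m R 1 (ltF m R a (ktAux m R b (ltF m R 1 ψ) (ltH m R 1 ψ)))
    (ltH m R a (ktAux m R b (ltF m R 1 ψ) (ltH m R 1 ψ)))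

/-- The inner chain `V̂(s)·V̂(s₂)···V̂(s_{j+1})·Û₀(s_{j+1},1)ψ` of the `n`-th Dyson term,
with the nested integrals `∫₁^{s}···` built in; `W s` is the spatial Fourier transform
of the potential at time `s`. -/
def dysonM (m R : ℝ) (W : ℝ → V3 → ℂ) : ℕ → ℝ → (V3 → ℂ) → V3 → ℂ
  | 0, s, ψ => vHatOp m R (W s) (u0Hat m R s 1 ψ)
  | j + 1, s, ψ => vHatOp m R (W s) fun k => ∫ r in Set.Ioc (1 : ℝ) s, dysonM m R W j r ψ k

/-- The `n`-th Dyson term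
`∫₁^t∫₁^{s₁}···∫₁^{s_{n−1}} Û₀(t,s₁)·V̂(s₁)···V̂(s_n)·Û₀(s_n,1)ψ ds_n···ds₁` (for `n ≥ 1`). -/
def dysonT (m R : ℝ) (W : ℝ → V3 → ℂ) (n : ℕ) (t : ℝ) (ψ : V3 → ℂ) : V3 → ℂ := fun k =>
  ∫ s in Set.Ioc (1 : ℝ) t, u0Hat m R t s (dysonM m R W (n - 1) s ψ) k


section
open Complex MeasureTheory Filter
open scoped RealInnerProductSpace

/-- power series with real argument -/
noncomputable def psf (c : ℕ → ℂ) (x : ℝ) : ℂ := ∑' n : ℕ, c n * (x : ℂ) ^ n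

/-- coefficients of the derivative -/
noncomputable def dco (c : ℕ → ℂ) (n : ℕ) : ℂ := ((n : ℂ) + 1) * c (n + 1)

/-- exponential-type coefficient bound -/
def CB (K : ℝ) (c : ℕ → ℂ) : Prop := ∀ n : ℕ, ‖c n‖ ≤ K / (n.factorial : ℝ)

lemma CB.dd {K : ℝ} {c : ℕ → ℂ} (h : CB K c) : CB K (dco c) := by
  intro n
  unfold dco
  have h1 := h (n + 1)
  rw [norm_mul]
  have h2 : ‖((n : ℂ) + 1)‖ = (n : ℝ) + 1 := by
    rw [← Nat.cast_succ, Complex.norm_natCast]; push_cast; ring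
  rw [h2]
  have h3 : (0 : ℝ) < n.factorial := by exact_mod_cast n.factorial_pos
  calc ((n : ℝ) + 1) * ‖c (n + 1)‖ ≤ ((n : ℝ) + 1) * (K / ((n + 1).factorial : ℝ)) := by gcongr
    _ = K / n.factorial := by
      rw [Nat.factorial_succ]; push_cast; field_simp

lemma CB.summable {K : ℝ} {c : ℕ → ℂ} (h : CB K c) (x : ℝ) :
    Summable (fun n : ℕ => c n * (x : ℂ) ^ n) := by
  have h1 : Summable (fun n : ℕ => K * (|x| ^ n / (n.factorial : ℝ))) :=
    (Real.summable_pow_div_factorial |x|).mul_left K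
  refine Summable.of_norm_bounded h1 (fun n => ?_)
  rw [norm_mul, norm_pow, Complex.norm_real, Real.norm_eq_abs]
  calc ‖c n‖ * |x| ^ n ≤ (K / n.factorial) * |x| ^ n := by gcongr; exact h n
    _ = _ := by ring

lemma CB.hasDerivAt {K : ℝ} {c : ℕ → ℂ} (h : CB K c) (x : ℝ) :
    HasDerivAt (psf c) (psf (dco c) x) x := by
  have hK : 0 ≤ K := by
    have := (norm_nonneg _).trans (h 0); simpa using this
  set r : ℝ := |x| + 1 with hr
  have hr0 : 0 < r := by positivity
  have hmem : x ∈ Metric.ball (0 : ℝ) r := by simp [hr]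
  let u : ℕ → ℝ := fun n => (n : ℝ) * ‖c n‖ * r ^ (n - 1)
  have hu : Summable u := by
    rw [← summable_nat_add_iff 1]
    have h1 : Summable (fun n : ℕ => K * (r ^ n / (n.factorial : ℝ))) :=
      (Real.summable_pow_div_factorial r).mul_left K
    refine Summable.of_nonneg_of_le (fun n => by positivity) (fun n => ?_) h1
    have h2 := h.dd n
    have h3 : ‖((n : ℂ) + 1)‖ = (n : ℝ) + 1 := by
      rw [← Nat.cast_succ, Complex.norm_natCast]; push_cast; ring
    simp only [u, Nat.add_sub_cancel]
    rw [dco, norm_mul, h3] at h2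
    push_cast
    calc _ ≤ (K / n.factorial) * r ^ n := by gcongr
      _ = _ := by ring
  have key := hasDerivAt_tsum_of_isPreconnected (𝕜 := ℝ) (F := ℂ)
    (g := fun (n : ℕ) (y : ℝ) => c n * (y : ℂ) ^ n)
    (g' := fun (n : ℕ) (y : ℝ) => c n * ((n : ℂ) * (y : ℂ) ^ (n - 1))) hu
    (Metric.isOpen_ball (x := (0 : ℝ)) (ε := r)) (convex_ball (0 : ℝ) r).isPreconnected
    (fun n y _ => by
      have := (((hasDerivAt_id y).ofReal_comp).pow n).const_mul (c n)
      simpa using this)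
    (fun n y hy => by
      rw [norm_mul, norm_mul, norm_pow, Complex.norm_natCast, Complex.norm_real]
      have hy' : ‖y‖ ≤ r := by simpa using (mem_ball_zero_iff.mp hy).le
      simp only [u]
      calc ‖c n‖ * (↑n * ‖y‖ ^ (n - 1)) ≤ ‖c n‖ * (↑n * r ^ (n - 1)) := by gcongr
        _ = _ := by ring)
    hmem (h.summable x) hmem
  have e : psf (dco c) x = ∑' n : ℕ, c n * ((n : ℂ) * (x : ℂ) ^ (n - 1)) := by
    have hs : Summable (fun n : ℕ => c (n+1) * (((n+1 : ℕ) : ℂ) * (x : ℂ) ^ ((n+1) - 1))) := by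
      refine (h.dd.summable x).congr (fun n => ?_)
      simp [dco]; ring
    have hs' := (summable_nat_add_iff (f := fun n : ℕ => c n * ((n : ℂ) * (x : ℂ) ^ (n - 1))) 1).mp hs
    rw [hs'.tsum_eq_zero_add]
    simp only [psf, dco]
    simp
    refine tsum_congr (fun n => by ring)
  rw [e]
  exact key

lemma psf_ode {K : ℝ} {c : ℕ → ℂ} (h : CB K c) (α : ℂ)
    (hrec : ∀ n : ℕ, ((n : ℂ) + 1) * (α + n + 1) * c (n + 1) = - c n) (x : ℝ) :
    (x : ℂ) * psf (dco (dco c)) x + (α + 1) * psf (dco c) x + psf c x = 0 := by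
  have e : (x : ℂ) * psf (dco (dco c)) x = ∑' n : ℕ, (n : ℂ) * dco c n * (x : ℂ) ^ n := by
    have hs : Summable (fun n : ℕ => ((n+1 : ℕ) : ℂ) * dco c (n+1) * (x : ℂ) ^ (n+1)) := by
      refine ((h.dd.dd.summable x).mul_left (x : ℂ)).congr (fun n => ?_)
      simp [dco]; ring
    have hs' := (summable_nat_add_iff (f := fun n : ℕ => (n : ℂ) * dco c n * (x : ℂ) ^ n) 1).mp hs
    rw [hs'.tsum_eq_zero_add, psf, ← tsum_mul_left]
    simp only [Nat.cast_zero, zero_mul, zero_add]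
    refine tsum_congr (fun n => ?_)
    simp [dco]; ring
  have hs2 : Summable (fun n : ℕ => (n : ℂ) * dco c n * (x : ℂ) ^ n) := by
    rw [← summable_nat_add_iff 1]
    refine ((h.dd.dd.summable x).mul_left (x : ℂ)).congr (fun n => ?_)
    simp [dco]; ring
  rw [e]
  have h1 := (h.dd.summable x).mul_left (α + 1)
  have h2 := h.summable x
  rw [psf, psf, ← tsum_mul_left, ← hs2.tsum_add h1, ← (hs2.add h1).tsum_add h2]
  convert tsum_zero with n
  have := hrec n
  simp only [dco]
  linear_combination (x : ℂ) ^ n * this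

/-- Bessel coefficients -/
noncomputable def bco (α : ℂ) (n : ℕ) : ℂ := (-1 : ℂ) ^ n / ((n.factorial : ℂ) * Complex.Gamma (α + (n : ℂ) + 1))

lemma ne_aux {α : ℂ} (hα : α.re = 0) (n : ℕ) : α + (n : ℂ) + 1 ≠ 0 := by
  intro h0
  have := congrArg Complex.re h0
  simp [hα] at this
  have h : (0:ℝ) ≤ n := Nat.cast_nonneg n
  linarith

lemma bco_rec {α : ℂ} (hα : α.re = 0) (n : ℕ) :
    ((n : ℂ) + 1) * (α + n + 1) * bco α (n + 1) = - bco α n := by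
  have hne := ne_aux hα n
  have hG : Complex.Gamma (α + (n : ℂ) + 1) ≠ 0 := by
    apply Complex.Gamma_ne_zero_of_re_pos
    simp [hα]; positivity
  have hf : (n.factorial : ℂ) ≠ 0 := by exact_mod_cast n.factorial_ne_zero
  have hn : (n : ℂ) + 1 ≠ 0 := by exact_mod_cast n.succ_ne_zero
  unfold bco
  have : α + ((n + 1 : ℕ) : ℂ) + 1 = (α + n + 1) + 1 := by push_cast; ring
  rw [this, Complex.Gamma_add_one _ hne, Nat.factorial_succ]
  push_cast
  field_simp
  ring

lemma bco_CB {α : ℂ} (hα : α.re = 0) : CB ‖bco α 0‖ (bco α) := by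
  intro n
  induction n with
  | zero => simp
  | succ n ih =>
    have h1 := congrArg norm (bco_rec hα n)
    rw [norm_mul, norm_mul, norm_neg] at h1
    have h3 : ‖((n : ℂ) + 1)‖ = (n : ℝ) + 1 := by
      rw [← Nat.cast_succ, Complex.norm_natCast]; push_cast; ring
    have h4 : 1 ≤ ‖α + n + 1‖ := by
      have := Complex.re_le_norm (α + n + 1)
      simp [hα] at this
      have h : (0:ℝ) ≤ n := Nat.cast_nonneg n
      linarith
    rw [h3] at h1
    have h5 : ((n : ℝ) + 1) * ‖bco α (n + 1)‖ ≤ ‖bco α n‖ := by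
      rw [← h1]
      have : ((n : ℝ) + 1) * 1 * ‖bco α (n + 1)‖ ≤ ((n : ℝ) + 1) * ‖α + n + 1‖ * ‖bco α (n + 1)‖ := by gcongr
      linarith
    have h6 := h5.trans ih
    have hf : (0 : ℝ) < n.factorial := by exact_mod_cast n.factorial_pos
    rw [Nat.factorial_succ]
    push_cast
    rw [le_div_iff₀ (by positivity)]
    rw [le_div_iff₀ hf] at h6
    linarith

end

section
open Complex MeasureTheory Filter
open scoped RealInnerProductSpace

def bP (α : ℂ) (x : ℝ) : ℂ := Complex.exp (α * (Real.log (x / 2) : ℂ))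

def bF (α : ℂ) (x : ℝ) : ℂ := psf (bco α) (x ^ 2 / 4)
def bF1 (α : ℂ) (x : ℝ) : ℂ := psf (dco (bco α)) (x ^ 2 / 4)
def bF2 (α : ℂ) (x : ℝ) : ℂ := psf (dco (dco (bco α))) (x ^ 2 / 4)

def bJ1 (α : ℂ) (x : ℝ) : ℂ := bP α x * (α / x * bF α x + x / 2 * bF1 α x)

def bJ2 (α : ℂ) (x : ℝ) : ℂ :=
  bP α x * (α / x) * (α / x * bF α x + x / 2 * bF1 α x) +
  bP α x * (-(α / x ^ 2) * bF α x + α / x * (x / 2 * bF1 α x) + (1 / 2 * bF1 α x +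
    x / 2 * (x / 2 * bF2 α x)))

lemma besselJ_eq (α : ℂ) {x : ℝ} (hx : 0 < x) : besselJ α x = bP α x * bF α x := by
  unfold besselJ bP bF psf
  rw [← tsum_mul_left]
  refine tsum_congr (fun n => ?_)
  have h1 : Complex.exp ((α + 2 * (n : ℂ)) * (Real.log (x / 2) : ℂ)) =
      Complex.exp (α * (Real.log (x / 2) : ℂ)) * ((x ^ 2 / 4 : ℝ) : ℂ) ^ n := by
    rw [add_mul, Complex.exp_add]
    congr 1
    have h2 : (2 * (n : ℂ)) * (Real.log (x / 2) : ℂ) = ((2 * n : ℕ) : ℂ) * (Real.log (x / 2) : ℂ) := by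
      push_cast; ring
    rw [h2, Complex.exp_nat_mul, ← Complex.ofReal_exp, Real.exp_log (by positivity), pow_mul]
    congr 1
    push_cast; ring
  rw [h1, bco]; ring

lemma bP_deriv (α : ℂ) {x : ℝ} (hx : 0 < x) : HasDerivAt (bP α) (bP α x * (α / x)) x := by
  have h1 : HasDerivAt (fun y : ℝ => Real.log (y / 2)) (1 / x) x := by
    have := (((hasDerivAt_id x).div_const 2).log (by simp; exact hx.ne'))
    refine HasDerivAt.congr_deriv this ?_
    simp only [id]; field_simp
  have := ((h1.ofReal_comp).const_mul α).cexp
  refine HasDerivAt.congr_deriv this ?_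
  simp [bP]; ring

lemma sq_deriv (x : ℝ) : HasDerivAt (fun y : ℝ => y ^ 2 / 4) (x / 2) x := by
  have := ((hasDerivAt_id x).pow 2).div_const 4
  refine HasDerivAt.congr_deriv this ?_
  simp; ring

lemma bF_deriv {α : ℂ} (hα : α.re = 0) (x : ℝ) : HasDerivAt (bF α) (x / 2 * bF1 α x) x := by
  have := ((bco_CB hα).hasDerivAt (x ^ 2 / 4)).scomp x (sq_deriv x)
  refine HasDerivAt.congr_deriv this ?_
  simp [bF1]

lemma bF1_deriv {α : ℂ} (hα : α.re = 0) (x : ℝ) : HasDerivAt (bF1 α) (x / 2 * bF2 α x) x := by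
  have := ((bco_CB hα).dd.hasDerivAt (x ^ 2 / 4)).scomp x (sq_deriv x)
  refine HasDerivAt.congr_deriv this ?_
  simp [bF2]

lemma bF2_cont {α : ℂ} (hα : α.re = 0) : Continuous (bF2 α) := by
  have : Continuous (psf (dco (dco (bco α)))) :=
    continuous_iff_continuousAt.mpr (fun x => ((bco_CB hα).dd.dd.hasDerivAt x).continuousAt)
  exact this.comp (by fun_prop)

lemma besselJ_deriv {α : ℂ} (hα : α.re = 0) {x : ℝ} (hx : 0 < x) :
    HasDerivAt (besselJ α) (bJ1 α x) x := by
  have h := (bP_deriv α hx).mul (bF_deriv hα x)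
  have h2 : HasDerivAt (fun y => bP α y * bF α y) (bJ1 α x) x := by
    refine HasDerivAt.congr_deriv h ?_
    simp only [bJ1]; ring
  refine h2.congr_of_eventuallyEq ?_
  filter_upwards [lt_mem_nhds hx] with y hy
  exact besselJ_eq α hy

lemma bJ1_deriv {α : ℂ} (hα : α.re = 0) {x : ℝ} (hx : 0 < x) :
    HasDerivAt (bJ1 α) (bJ2 α x) x := by
  have hx' : (x : ℂ) ≠ 0 := by exact_mod_cast hx.ne'
  have hid : HasDerivAt (fun y : ℝ => (y : ℂ)) 1 x := by
    simpa using (hasDerivAt_id x).ofReal_comp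
  have hinv : HasDerivAt (fun y : ℝ => α / (y : ℂ)) (-(α / x ^ 2)) x := by
    have := (hasDerivAt_const x α).div hid hx'
    refine HasDerivAt.congr_deriv this ?_
    simp; ring
  have hhalf : HasDerivAt (fun y : ℝ => (y : ℂ) / 2) (1 / 2) x := hid.div_const 2
  have h := (bP_deriv α hx).mul ((hinv.mul (bF_deriv hα x)).add (hhalf.mul (bF1_deriv hα x)))
  exact h

lemma bessel_ode {α : ℂ} (hα : α.re = 0) {x : ℝ} (hx : 0 < x) :
    (x : ℂ) ^ 2 * bJ2 α x + x * bJ1 α x + (x ^ 2 - α ^ 2) * besselJ α x = 0 := by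
  have hx' : (x : ℂ) ≠ 0 := by exact_mod_cast hx.ne'
  have h := psf_ode (bco_CB hα) α (bco_rec hα) (x ^ 2 / 4)
  rw [besselJ_eq α hx]
  simp only [bJ2, bJ1]
  change ((x ^ 2 / 4 : ℝ) : ℂ) * bF2 α x + (α + 1) * bF1 α x + bF α x = 0 at h
  push_cast at h
  field_simp
  linear_combination (4 * (x : ℂ) ^ 2 * bP α x) * h

lemma psf_zero (c : ℕ → ℂ) : psf c 0 = c 0 := by
  unfold psf
  rw [tsum_eq_single 0]
  · simp
  · intro n hn; simp [hn]

/-- the Wronskian-type function is constant -/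
lemma wr_const {α : ℂ} (hα : α.re = 0) (z : ℝ) :
    -(2 * α) * psf (bco α) z * psf (bco (-α)) z +
      2 * (z : ℂ) * (psf (bco α) z * psf (dco (bco (-α))) z - psf (bco (-α)) z * psf (dco (bco α)) z)
      = -(2 * α) * bco α 0 * bco (-α) 0 := by
  have hα' : (-α).re = 0 := by simp [hα]
  have a0 := bco_CB hα
  have b0 := bco_CB hα'
  set G : ℝ → ℂ := fun z => -(2 * α) * psf (bco α) z * psf (bco (-α)) z +
      2 * (z : ℂ) * (psf (bco α) z * psf (dco (bco (-α))) z - psf (bco (-α)) z * psf (dco (bco α)) z) with hG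
  have hd : ∀ y, HasDerivAt G 0 y := by
    intro y
    have hid : HasDerivAt (fun y : ℝ => 2 * (y : ℂ)) (2 * 1) y := by
      simpa using ((hasDerivAt_id y).ofReal_comp).const_mul (2 : ℂ)
    have h1 := (((a0.hasDerivAt y).const_mul (-(2 * α))).mul (b0.hasDerivAt y)).add
      (hid.mul (((a0.hasDerivAt y).mul (b0.dd.hasDerivAt y)).sub
        ((b0.hasDerivAt y).mul (a0.dd.hasDerivAt y))))
    have e1 := psf_ode a0 α (bco_rec hα) y
    have e2 := psf_ode b0 (-α) (bco_rec hα') y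
    refine HasDerivAt.congr_deriv h1 ?_
    simp only [Pi.sub_apply, Pi.mul_apply]
    linear_combination (-2) * psf (bco (-α)) y * e1 + 2 * psf (bco α) y * e2
  have hc := is_const_of_deriv_eq_zero (fun y => (hd y).differentiableAt) (fun y => (hd y).deriv) z 0
  change G z = _
  rw [hc, hG]
  simp [psf_zero]

lemma bP_mul (α : ℂ) (x : ℝ) : bP α x * bP (-α) x = 1 := by
  simp [bP, ← Complex.exp_add]

lemma bco_zero_mul {α : ℂ} (hα : α.re = 0) (hα0 : α ≠ 0) :
    α * bco α 0 * bco (-α) 0 = Complex.sin (Real.pi * α) / Real.pi := by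
  have hs : Complex.sin (Real.pi * α) ≠ 0 := by
    rw [Complex.sin_ne_zero_iff]
    intro k hk
    have hpi : (Real.pi : ℂ) ≠ 0 := by exact_mod_cast Real.pi_ne_zero
    have h1 : α = k := by
      apply mul_left_cancel₀ hpi
      rw [hk]; ring
    rw [h1] at hα hα0
    simp at hα hα0
    exact hα0 hα
  have h1 := Complex.Gamma_mul_Gamma_one_sub α
  have h2 := Complex.Gamma_add_one α hα0
  have hpi : (Real.pi : ℂ) ≠ 0 := by exact_mod_cast Real.pi_ne_zero
  have h3 : bco α 0 = 1 / (α * Complex.Gamma α) := by simp [bco, h2]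
  have h4 : bco (-α) 0 = 1 / Complex.Gamma (1 - α) := by
    simp [bco]; congr 1; ring
  have h5 : Complex.Gamma α * Complex.Gamma (1 - α) ≠ 0 := by
    rw [h1]; exact div_ne_zero hpi hs
  have h6 := left_ne_zero_of_mul h5
  have h7 := right_ne_zero_of_mul h5
  rw [h3, h4]
  rw [eq_div_iff hs] at h1
  field_simp
  rw [mul_comm α (Real.pi : ℂ)]
  linear_combination -h1

lemma bessel_wronskian {α : ℂ} (hα : α.re = 0) (hα0 : α ≠ 0) {x : ℝ} (hx : 0 < x) :
    (x : ℂ) * (besselJ α x * bJ1 (-α) x - bJ1 α x * besselJ (-α) x) =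
      - 2 * Complex.sin (Real.pi * α) / Real.pi := by
  have hx' : (x : ℂ) ≠ 0 := by exact_mod_cast hx.ne'
  have h1 := wr_const hα (x ^ 2 / 4)
  have h2 := bco_zero_mul hα hα0
  have h3 := bP_mul α x
  rw [besselJ_eq α hx, besselJ_eq (-α) hx]
  change -(2 * α) * bF α x * bF (-α) x + 2 * ((x ^ 2 / 4 : ℝ) : ℂ) * (bF α x * bF1 (-α) x - bF (-α) x * bF1 α x) = _ at h1
  push_cast at h1
  have h4 : (x : ℂ) * (bP α x * bF α x * bJ1 (-α) x - bJ1 α x * (bP (-α) x * bF (-α) x)) =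
      (bP α x * bP (-α) x) * (-(2 * α) * bF α x * bF (-α) x + 2 * ((x : ℂ) ^ 2 / 4) * (bF α x * bF1 (-α) x - bF (-α) x * bF1 α x)) := by
    simp only [bJ1]
    field_simp
    ring
  rw [h4, h3, h1]
  linear_combination (-2) * h2

lemma bco_conj (α : ℂ) (n : ℕ) : (starRingEnd ℂ) (bco α n) = bco ((starRingEnd ℂ) α) n := by
  simp [bco, ← Complex.Gamma_conj]

lemma psf_conj (c : ℕ → ℂ) (x : ℝ) : (starRingEnd ℂ) (psf c x) = psf (fun n => (starRingEnd ℂ) (c n)) x := by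
  unfold psf
  rw [Complex.conj_tsum]
  simp only [map_mul, map_pow, Complex.conj_ofReal]

lemma bF_conj (α : ℂ) (x : ℝ) : (starRingEnd ℂ) (bF α x) = bF ((starRingEnd ℂ) α) x := by
  simp only [bF, psf_conj, bco_conj]

lemma bF1_conj (α : ℂ) (x : ℝ) : (starRingEnd ℂ) (bF1 α x) = bF1 ((starRingEnd ℂ) α) x := by
  simp only [bF1, psf_conj]
  congr 1
  funext n
  simp [dco, bco_conj]

lemma bP_conj (α : ℂ) (x : ℝ) : (starRingEnd ℂ) (bP α x) = bP ((starRingEnd ℂ) α) x := by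
  simp [bP, ← Complex.exp_conj]

lemma besselJ_conj (α : ℂ) {x : ℝ} (hx : 0 < x) :
    (starRingEnd ℂ) (besselJ α x) = besselJ ((starRingEnd ℂ) α) x := by
  rw [besselJ_eq _ hx, besselJ_eq _ hx, map_mul, bP_conj, bF_conj]

lemma bJ1_conj (α : ℂ) (x : ℝ) :
    (starRingEnd ℂ) (bJ1 α x) = bJ1 ((starRingEnd ℂ) α) x := by
  have h2 : (starRingEnd ℂ) 2 = 2 := Complex.conj_ofNat 2
  simp [bJ1, bP_conj, bF_conj, bF1_conj, h2]

/-! Hankel function -/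

def hC (μ : ℝ) : ℂ := (Real.exp (-(μ * Real.pi / 2)) : ℂ)
def hS (μ : ℝ) : ℂ := (Complex.I * Complex.sin (Complex.I * μ * (Real.pi : ℂ)))
def hE (μ : ℝ) : ℂ := Complex.exp (-(Complex.I * (Real.pi : ℂ) * (Complex.I * μ)))

def hH (μ : ℝ) (x : ℝ) : ℂ := hC μ * hankel1 (Complex.I * μ) x
def hH1 (μ : ℝ) (x : ℝ) : ℂ :=
  hC μ * ((bJ1 (-(Complex.I * μ)) x - hE μ * bJ1 (Complex.I * μ) x) / hS μ)
def hH2 (μ : ℝ) (x : ℝ) : ℂ :=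
  hC μ * ((bJ2 (-(Complex.I * μ)) x - hE μ * bJ2 (Complex.I * μ) x) / hS μ)

lemma re_I (μ : ℝ) : (Complex.I * μ).re = 0 := by simp
lemma re_I' (μ : ℝ) : (-(Complex.I * μ)).re = 0 := by simp

lemma hH_deriv (μ : ℝ) {x : ℝ} (hx : 0 < x) : HasDerivAt (hH μ) (hH1 μ x) x :=
  (((besselJ_deriv (re_I' μ) hx).sub ((besselJ_deriv (re_I μ) hx).const_mul (hE μ))).div_const
    (hS μ)).const_mul (hC μ)

lemma hH1_deriv (μ : ℝ) {x : ℝ} (hx : 0 < x) : HasDerivAt (hH1 μ) (hH2 μ x) x :=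
  (((bJ1_deriv (re_I' μ) hx).sub ((bJ1_deriv (re_I μ) hx).const_mul (hE μ))).div_const
    (hS μ)).const_mul (hC μ)

lemma hH_ode (μ : ℝ) {x : ℝ} (hx : 0 < x) :
    (x : ℂ) ^ 2 * hH2 μ x + x * hH1 μ x + (x ^ 2 + μ ^ 2) * hH μ x = 0 := by
  have h1 := bessel_ode (re_I μ) hx
  have h2 := bessel_ode (re_I' μ) hx
  simp only [hH, hH1, hH2, hankel1]
  change _ + _ + _ * (hC μ * ((_ - hE μ * _) / hS μ)) = 0
  have h3 : (Complex.I * (μ : ℂ)) ^ 2 = - (μ : ℂ) ^ 2 := by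
    rw [mul_pow, Complex.I_sq]; ring
  rw [neg_sq, h3] at h2
  rw [h3] at h1
  linear_combination (hC μ / hS μ) * h2 - (hC μ * hE μ / hS μ) * h1

lemma hH_wronskian {μ : ℝ} (hμ : 0 < μ) {x : ℝ} (hx : 0 < x) :
    hH μ x * (starRingEnd ℂ) (hH1 μ x) - (starRingEnd ℂ) (hH μ x) * hH1 μ x =
      -(4 * Complex.I) / (Real.pi * x) := by
  have hx' : (x : ℂ) ≠ 0 := by exact_mod_cast hx.ne'
  have hpi : (Real.pi : ℂ) ≠ 0 := by exact_mod_cast Real.pi_ne_zero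
  have hν0 : Complex.I * (μ : ℂ) ≠ 0 := mul_ne_zero Complex.I_ne_zero (by exact_mod_cast hμ.ne')
  have hw := bessel_wronskian (re_I μ) hν0 hx
  have hcν : (starRingEnd ℂ) (Complex.I * (μ : ℂ)) = -(Complex.I * μ) := by simp
  have hcν' : (starRingEnd ℂ) (-(Complex.I * (μ : ℂ))) = (Complex.I * μ) := by simp
  set a : ℝ := Real.exp (μ * Real.pi) with ha
  set s : ℝ := Real.sinh (μ * Real.pi) with hs
  have hs0 : (s : ℂ) ≠ 0 := by
    have : 0 < s := Real.sinh_pos_iff.mpr (by positivity)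
    exact_mod_cast this.ne'
  have ha0 : (a : ℂ) ≠ 0 := by exact_mod_cast (Real.exp_pos _).ne'
  have hsin : Complex.sin (Real.pi * (Complex.I * μ)) = s * Complex.I := by
    rw [show (Real.pi : ℂ) * (Complex.I * μ) = ((μ * Real.pi : ℝ) : ℂ) * Complex.I by push_cast; ring,
      Complex.sin_mul_I, hs, Complex.ofReal_sinh]
  have hSe : hS μ = -(s : ℂ) := by
    unfold hS
    rw [show (Complex.I * μ * (Real.pi : ℂ)) = (Real.pi * (Complex.I * μ)) by ring, hsin]
    linear_combination (s : ℂ) * Complex.I_mul_I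
  have hEe : hE μ = (a : ℂ) := by
    unfold hE
    rw [ha, Complex.ofReal_exp]
    congr 1
    push_cast
    linear_combination (-(Real.pi : ℂ) * μ) * Complex.I_mul_I
  have hsa : 2 * (s : ℂ) * a = a ^ 2 - 1 := by
    have : 2 * s * a = a ^ 2 - 1 := by
      rw [hs, Real.sinh_eq, ha, Real.exp_neg]
      have := (Real.exp_pos (μ * Real.pi)).ne'
      field_simp
    exact_mod_cast this
  have hCa : hC μ ^ 2 * a = 1 := by
    unfold hC
    have : Real.exp (-(μ * Real.pi / 2)) ^ 2 * a = 1 := by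
      rw [ha, sq, ← Real.exp_add, ← Real.exp_add]
      simp; ring
    exact_mod_cast this
  have hCc : (starRingEnd ℂ) (hC μ) = hC μ := Complex.conj_ofReal _
  have e0 : hH μ x = hC μ * ((besselJ (-(Complex.I * μ)) x - a * besselJ (Complex.I * μ) x) / (-s)) := by
    rw [← hSe, ← hEe]; rfl
  have e1 : hH1 μ x = hC μ * ((bJ1 (-(Complex.I * μ)) x - a * bJ1 (Complex.I * μ) x) / (-s)) := by
    rw [← hSe, ← hEe]; rfl
  have c0 : (starRingEnd ℂ) (hH μ x) = hC μ * ((besselJ (Complex.I * μ) x - a * besselJ (-(Complex.I * μ)) x) / (-s)) := by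
    rw [e0, map_mul, hCc, map_div₀, map_sub, map_mul, besselJ_conj _ hx, besselJ_conj _ hx, hcν, hcν']
    simp [Complex.conj_ofReal]
  have c1 : (starRingEnd ℂ) (hH1 μ x) = hC μ * ((bJ1 (Complex.I * μ) x - a * bJ1 (-(Complex.I * μ)) x) / (-s)) := by
    rw [e1, map_mul, hCc, map_div₀, map_sub, map_mul, bJ1_conj, bJ1_conj, hcν, hcν']
    simp [Complex.conj_ofReal]
  rw [c0, c1, e0, e1]
  rw [hsin] at hw
  set J := besselJ (Complex.I * μ) x
  set Jm := besselJ (-(Complex.I * μ)) x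
  set K := bJ1 (Complex.I * μ) x
  set Km := bJ1 (-(Complex.I * μ)) x
  have hw' : J * Km - K * Jm = - 2 * (s * Complex.I) / (Real.pi * x) := by
    field_simp
    field_simp at hw
    linear_combination hw
  have : hC μ * ((Jm - a * J) / (-s)) * (hC μ * ((K - a * Km) / (-s))) -
      hC μ * ((J - a * Jm) / (-s)) * (hC μ * ((Km - a * K) / (-s))) =
      hC μ ^ 2 * (a ^ 2 - 1) / s ^ 2 * (J * Km - K * Jm) := by
    field_simp
    ring
  rw [this, hw', ← hsa, show hC μ ^ 2 * (2 * s * a) = (hC μ ^ 2 * a) * (2 * s) by ring, hCa]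
  field_simp
  ring
end

section
open Complex MeasureTheory Filter
open scoped RealInnerProductSpace

def tp (t : ℝ) : ℂ := ((t ^ ((3 : ℝ) / 2) : ℝ) : ℂ)

def vv (μ t k : ℝ) : ℂ := tp t * hH μ (k * t)
def vv1 (μ t k : ℝ) : ℂ := tp t * (k * hH1 μ (k * t) + 3 / (2 * t) * hH μ (k * t))
def vv2 (μ t k : ℝ) : ℂ := tp t * (k ^ 2 * hH2 μ (k * t) + 3 / t * (k * hH1 μ (k * t)) +
  3 / (4 * t ^ 2) * hH μ (k * t))

lemma modeV_eq (m R t k : ℝ) : modeV m R t k = vv (modeMu m R) t k := by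
  simp only [modeV, vv, hH, hC, tp, modeNu]; ring

lemma tp_deriv {t : ℝ} (ht : 0 < t) : HasDerivAt tp (3 / (2 * t) * tp t) t := by
  have h := (Real.hasDerivAt_rpow_const (x := t) (p := (3 : ℝ) / 2) (Or.inl ht.ne')).ofReal_comp
  refine HasDerivAt.congr_deriv h ?_
  have h2 : t ^ ((3 : ℝ) / 2) = t * t ^ ((3 : ℝ) / 2 - 1) := by
    rw [← Real.rpow_one_add' ht.le (by norm_num)]; norm_num
  have ht' : (t : ℂ) ≠ 0 := by exact_mod_cast ht.ne'
  simp only [tp]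
  rw [h2]
  push_cast
  field_simp

lemma kt_deriv (k t : ℝ) : HasDerivAt (fun s : ℝ => k * s) k t := by
  simpa using (hasDerivAt_id t).const_mul k

lemma vv_deriv (μ : ℝ) {t k : ℝ} (ht : 0 < t) (hk : 0 < k) :
    HasDerivAt (fun s => vv μ s k) (vv1 μ t k) t := by
  have h := (tp_deriv ht).mul ((hH_deriv μ (mul_pos hk ht)).scomp t (kt_deriv k t))
  refine HasDerivAt.congr_deriv h ?_
  simp only [vv1, Function.comp, Complex.real_smul]
  ring

lemma vv1_deriv (μ : ℝ) {t k : ℝ} (ht : 0 < t) (hk : 0 < k) :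
    HasDerivAt (fun s => vv1 μ s k) (vv2 μ t k) t := by
  have ht' : (t : ℂ) ≠ 0 := by exact_mod_cast ht.ne'
  have hid : HasDerivAt (fun y : ℝ => 2 * (y : ℂ)) (2 * 1) t := by
    simpa using ((hasDerivAt_id t).ofReal_comp).const_mul (2 : ℂ)
  have hinv := (hasDerivAt_const t (3 : ℂ)).div hid (by simpa using ht')
  have h0 := (hH_deriv μ (mul_pos hk ht)).scomp t (kt_deriv k t)
  have h1 := (hH1_deriv μ (mul_pos hk ht)).scomp t (kt_deriv k t)
  have h := (tp_deriv ht).mul ((h1.const_mul (k : ℂ)).add (hinv.mul h0))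
  refine HasDerivAt.congr_deriv h ?_
  simp only [vv2, Function.comp, Complex.real_smul, Pi.add_apply, Pi.mul_apply, Pi.div_apply]
  field_simp
  ring

lemma vv_ode (μ : ℝ) {t k : ℝ} (ht : 0 < t) (hk : 0 < k) :
    (t : ℂ) ^ 2 * (vv2 μ t k + k ^ 2 * vv μ t k) - 2 * t * vv1 μ t k +
      (μ ^ 2 + 9 / 4) * vv μ t k = 0 := by
  have ht' : (t : ℂ) ≠ 0 := by exact_mod_cast ht.ne'
  have h := hH_ode μ (mul_pos hk ht)
  simp only [vv, vv1, vv2]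
  push_cast at h
  field_simp
  linear_combination (4 * tp t) * h

lemma tp_conj (t : ℝ) : (starRingEnd ℂ) (tp t) = tp t := Complex.conj_ofReal _

lemma tp_sq {t : ℝ} (ht : 0 < t) : tp t ^ 2 = (t : ℂ) ^ 3 := by
  have : (t ^ ((3 : ℝ) / 2)) ^ 2 = t ^ 3 := by
    rw [← Real.rpow_natCast, ← Real.rpow_mul ht.le]; norm_num
  unfold tp
  exact_mod_cast this

lemma vv_wronskian {μ : ℝ} (hμ : 0 < μ) {t k : ℝ} (ht : 0 < t) (hk : 0 < k) :
    vv μ t k * (starRingEnd ℂ) (vv1 μ t k) - (starRingEnd ℂ) (vv μ t k) * vv1 μ t k =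
      -(4 * Complex.I) * t ^ 2 / Real.pi := by
  have ht' : (t : ℂ) ≠ 0 := by exact_mod_cast ht.ne'
  have hk' : (k : ℂ) ≠ 0 := by exact_mod_cast hk.ne'
  have hpi : (Real.pi : ℂ) ≠ 0 := by exact_mod_cast Real.pi_ne_zero
  have h := hH_wronskian hμ (mul_pos hk ht)
  have h2 : (starRingEnd ℂ) 2 = 2 := Complex.conj_ofNat 2
  have h3 : (starRingEnd ℂ) 3 = 3 := Complex.conj_ofNat 3
  have e : vv μ t k * (starRingEnd ℂ) (vv1 μ t k) - (starRingEnd ℂ) (vv μ t k) * vv1 μ t k =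
    tp t ^ 2 * k * (hH μ (k * t) * (starRingEnd ℂ) (hH1 μ (k * t)) - (starRingEnd ℂ) (hH μ (k * t)) * hH1 μ (k * t)) := by
    simp only [vv, vv1, map_mul, map_add, map_div₀, tp_conj, Complex.conj_ofReal, h2, h3]
    ring
  rw [e, h, tp_sq ht]
  push_cast
  field_simp

lemma modeV'_eq (m R : ℝ) {t k : ℝ} (ht : 0 < t) (hk : 0 < k) :
    modeV' m R t k = vv1 (modeMu m R) t k := by
  unfold modeV'
  have : (fun s => modeV m R s k) = fun s => vv (modeMu m R) s k := by
    funext s; exact modeV_eq m R s k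
  rw [this]
  exact (vv_deriv _ ht hk).deriv

lemma hH_contOn (μ : ℝ) : ContinuousOn (hH μ) (Set.Ioi 0) :=
  fun x hx => (hH_deriv μ hx).continuousAt.continuousWithinAt
lemma hH1_contOn (μ : ℝ) : ContinuousOn (hH1 μ) (Set.Ioi 0) :=
  fun x hx => (hH1_deriv μ hx).continuousAt.continuousWithinAt

lemma vv_cont (μ : ℝ) {t : ℝ} (ht : 0 < t) : ContinuousOn (fun k : V3 => vv μ t ‖k‖) {0}ᶜ := by
  have h : ContinuousOn (fun k : V3 => hH μ (‖k‖ * t)) {0}ᶜ :=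
    (hH_contOn μ).comp (by fun_prop) (fun k hk => mul_pos (norm_pos_iff.mpr hk) ht)
  exact continuousOn_const.mul h

lemma vv1_cont (μ : ℝ) {t : ℝ} (ht : 0 < t) : ContinuousOn (fun k : V3 => vv1 μ t ‖k‖) {0}ᶜ := by
  have h : ContinuousOn (fun k : V3 => hH μ (‖k‖ * t)) {0}ᶜ :=
    (hH_contOn μ).comp (by fun_prop) (fun k hk => mul_pos (norm_pos_iff.mpr hk) ht)
  have h1 : ContinuousOn (fun k : V3 => hH1 μ (‖k‖ * t)) {0}ᶜ :=
    (hH1_contOn μ).comp (by fun_prop) (fun k hk => mul_pos (norm_pos_iff.mpr hk) ht)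
  have h2 : ContinuousOn (fun k : V3 => ((‖k‖ : ℝ) : ℂ)) {0}ᶜ := by fun_prop
  exact continuousOn_const.mul ((h2.mul h1).add (continuousOn_const.mul h))

/-- Energy estimate -/
lemma energy_bound {y y1 y2 : ℝ → ℂ} {κ M a b t₀ t : ℝ} (ha : 0 < a) (hM : 0 ≤ M)
    (h0 : ∀ s, 0 < s → HasDerivAt y (y1 s) s) (h1 : ∀ s, 0 < s → HasDerivAt y1 (y2 s) s)
    (hode : ∀ s : ℝ, 0 < s → (s : ℂ) ^ 2 * (y2 s + κ ^ 2 * y s) - 2 * s * y1 s + M * y s = 0)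
    (ht₀ : t₀ ∈ Set.Icc a b) (ht : t ∈ Set.Icc a b) :
    ‖y1 t‖ ^ 2 + (1 + κ ^ 2) * ‖y t‖ ^ 2 ≤
      Real.exp ((4 / a + 1 + M / a ^ 2) * (b - a)) *
        (‖y1 t₀‖ ^ 2 + (1 + κ ^ 2) * ‖y t₀‖ ^ 2) := by
  set c := 4 / a + 1 + M / a ^ 2 with hc
  have hc0 : 0 ≤ c := by positivity
  set E : ℝ → ℝ := fun s => ‖y1 s‖ ^ 2 + (1 + κ ^ 2) * ‖y s‖ ^ 2 with hE
  set E' : ℝ → ℝ := fun s => 2 * ⟪y1 s, y2 s⟫ + (1 + κ ^ 2) * (2 * ⟪y s, y1 s⟫) with hE'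
  have hEpos : ∀ s, 0 ≤ E s := fun s => by positivity
  have hd : ∀ s, 0 < s → HasDerivAt E (E' s) s := fun s hs =>
    ((h1 s hs).norm_sq).add (((h0 s hs).norm_sq).const_mul _)
  have hb : ∀ s, a ≤ s → |E' s| ≤ c * E s := by
    intro s hs
    have hs0 : 0 < s := ha.trans_le hs
    have hs' : (s : ℂ) ≠ 0 := by exact_mod_cast hs0.ne'
    have hy2 : y2 s = (2 / s : ℝ) • y1 s - (κ ^ 2 + M / s ^ 2 : ℝ) • y s := by
      have := hode s hs0
      simp only [Complex.real_smul]
      push_cast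
      field_simp
      linear_combination this
    have e : E' s = 4 / s * ‖y1 s‖ ^ 2 + (1 - M / s ^ 2) * (2 * ⟪y s, y1 s⟫) := by
      simp only [hE', hy2, inner_sub_right, real_inner_smul_right, real_inner_self_eq_norm_sq]
      rw [real_inner_comm (y s) (y1 s)]
      ring
    have hin : |2 * ⟪y s, y1 s⟫| ≤ E s := by
      have h := abs_real_inner_le_norm (y s) (y1 s)
      rw [abs_mul, abs_two]
      have h2 := sq_nonneg (‖y s‖ - ‖y1 s‖)
      have h3 : 0 ≤ κ ^ 2 * ‖y s‖ ^ 2 := by positivity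
      simp only [hE]
      nlinarith
    have hE1 : ‖y1 s‖ ^ 2 ≤ E s := by
      have : 0 ≤ (1 + κ ^ 2) * ‖y s‖ ^ 2 := by positivity
      simp only [hE]; linarith
    have hMs : M / s ^ 2 ≤ M / a ^ 2 := by gcongr
    have hM0 : 0 ≤ M / s ^ 2 := by positivity
    have h1M : |1 - M / s ^ 2| ≤ 1 + M / a ^ 2 := by
      rw [abs_le]; constructor <;> linarith
    have h4 : 4 / s ≤ 4 / a := by gcongr
    rw [e]
    calc |4 / s * ‖y1 s‖ ^ 2 + (1 - M / s ^ 2) * (2 * ⟪y s, y1 s⟫)|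
        ≤ |4 / s * ‖y1 s‖ ^ 2| + |(1 - M / s ^ 2) * (2 * ⟪y s, y1 s⟫)| := abs_add_le _ _
      _ = 4 / s * ‖y1 s‖ ^ 2 + |1 - M / s ^ 2| * |2 * ⟪y s, y1 s⟫| := by
          rw [abs_mul (1 - M / s ^ 2), abs_of_nonneg (by positivity)]
      _ ≤ 4 / a * E s + (1 + M / a ^ 2) * E s := by gcongr
      _ = c * E s := by rw [hc]; ring
  have hexp : ∀ (d s : ℝ), HasDerivAt (fun s => Real.exp (d * s)) (Real.exp (d * s) * d) s := by
    intro d s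
    have := (kt_deriv d s).exp
    exact this
  have hmono : MonotoneOn (fun s => E s * Real.exp (c * s)) (Set.Icc a b) := by
    have hd2 : ∀ s, 0 < s → HasDerivAt (fun s => E s * Real.exp (c * s))
      (E' s * Real.exp (c * s) + E s * (Real.exp (c * s) * c)) s := fun s hs => (hd s hs).mul (hexp c s)
    refine monotoneOn_of_deriv_nonneg (convex_Icc a b)
      (fun s hs => (hd2 s (ha.trans_le hs.1)).continuousAt.continuousWithinAt)
      (fun s hs => ?_) (fun s hs => ?_)
    · rw [interior_Icc] at hs
      exact (hd2 s (ha.trans hs.1)).differentiableAt.differentiableWithinAt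
    · rw [interior_Icc] at hs
      rw [(hd2 s (ha.trans hs.1)).deriv]
      have := (abs_le.mp (hb s hs.1.le)).1
      have h5 := Real.exp_pos (c * s)
      nlinarith
  have hanti : AntitoneOn (fun s => E s * Real.exp (-c * s)) (Set.Icc a b) := by
    have hd2 : ∀ s, 0 < s → HasDerivAt (fun s => E s * Real.exp (-c * s))
      (E' s * Real.exp (-c * s) + E s * (Real.exp (-c * s) * -c)) s := fun s hs => (hd s hs).mul (hexp (-c) s)
    refine antitoneOn_of_deriv_nonpos (convex_Icc a b)
      (fun s hs => (hd2 s (ha.trans_le hs.1)).continuousAt.continuousWithinAt)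
      (fun s hs => ?_) (fun s hs => ?_)
    · rw [interior_Icc] at hs
      exact (hd2 s (ha.trans hs.1)).differentiableAt.differentiableWithinAt
    · rw [interior_Icc] at hs
      rw [(hd2 s (ha.trans hs.1)).deriv]
      have := (abs_le.mp (hb s hs.1.le)).2
      have h5 := Real.exp_pos (-c * s)
      nlinarith
  change E t ≤ Real.exp (c * (b - a)) * E t₀
  have key : ∃ d : ℝ, d ≤ c * (b - a) ∧ E t ≤ Real.exp d * E t₀ := by
    rcases le_total t t₀ with h | h
    · refine ⟨c * (t₀ - t), ?_, ?_⟩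
      · apply mul_le_mul_of_nonneg_left _ hc0
        linarith [ht.1, ht₀.2]
      · have := hmono ht ht₀ h
        simp only at this
        rw [mul_sub, Real.exp_sub, div_mul_eq_mul_div, le_div_iff₀ (Real.exp_pos _)]
        linarith
    · refine ⟨c * (t - t₀), ?_, ?_⟩
      · apply mul_le_mul_of_nonneg_left _ hc0
        linarith [ht.2, ht₀.1]
      · have := hanti ht₀ ht h
        simp only [neg_mul, Real.exp_neg] at this
        rw [mul_sub, Real.exp_sub, div_mul_eq_mul_div, le_div_iff₀ (Real.exp_pos _)]
        rw [← div_eq_mul_inv, ← div_eq_mul_inv, div_le_div_iff₀ (Real.exp_pos _) (Real.exp_pos _)] at this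
        linarith
  obtain ⟨d, hd1, hd2⟩ := key
  refine hd2.trans ?_
  have := hEpos t₀
  gcongr
end

section
open Complex MeasureTheory Filter
open scoped RealInnerProductSpace FourierTransform SchwartzMap

lemma ft_fourier (f : SchwartzMap V3 ℝ) (k : V3) :
    ft (fun x => (f x : ℂ)) k = (((2 * Real.pi) ^ (-(3 : ℝ) / 2) : ℝ) : ℂ) *
      (𝓕 (f.postcompCLM Complex.ofRealCLM : 𝓢(V3, ℂ))) ((2 * Real.pi)⁻¹ • k) := by
  unfold ft
  rw [SchwartzMap.fourier_coe, Real.fourier_eq']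
  congr 1
  refine integral_congr_ae (Eventually.of_forall fun x => ?_)
  simp only [SchwartzMap.postcompCLM_apply, Complex.ofRealCLM_apply, smul_eq_mul]
  congr 2
  rw [real_inner_smul_right, real_inner_comm]
  have hpi : (Real.pi : ℂ) ≠ 0 := by exact_mod_cast Real.pi_ne_zero
  push_cast
  field_simp

lemma two_pi_inv_ne : ((2 * Real.pi)⁻¹ : ℝ) ≠ 0 := by positivity

lemma ft_schwartz (f : SchwartzMap V3 ℝ) :
    ∃ S : 𝓢(V3, ℂ), ∀ k, ft (fun x => (f x : ℂ)) k = S k := by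
  let e : V3 ≃L[ℝ] V3 := ContinuousLinearEquiv.smulLeft (Units.mk0 ((2 * Real.pi)⁻¹ : ℝ) two_pi_inv_ne)
  refine ⟨(((2 * Real.pi) ^ (-(3 : ℝ) / 2) : ℝ) : ℂ) •
    SchwartzMap.compCLMOfContinuousLinearEquiv ℂ e (𝓕 (f.postcompCLM Complex.ofRealCLM : 𝓢(V3, ℂ))), fun k => ?_⟩
  rw [ft_fourier]
  rfl

lemma ft_conj (f : V3 → ℝ) (k : V3) :
    (starRingEnd ℂ) (ft (fun x => (f x : ℂ)) (-k)) = ft (fun x => (f x : ℂ)) k := by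
  unfold ft
  rw [map_mul, Complex.conj_ofReal, ← integral_conj]
  congr 1
  refine integral_congr_ae (Eventually.of_forall fun x => ?_)
  simp only [map_mul, Complex.conj_ofReal, ← Complex.exp_conj, map_neg, Complex.conj_I, inner_neg_left]
  push_cast
  congr 2
  ring

lemma ft_inv (f : SchwartzMap V3 ℝ) (x : V3) :
    (((2 * Real.pi) ^ (-(3 : ℝ) / 2) : ℝ) : ℂ) *
    ∫ k : V3, Complex.exp (Complex.I * (⟪k, x⟫ : ℂ)) * ft (fun x => (f x : ℂ)) k = f x := by
  set fC : 𝓢(V3, ℂ) := f.postcompCLM Complex.ofRealCLM with hfC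
  have h1 : 𝓕⁻ (𝓕 fC) = fC := FourierTransform.fourierInv_fourier_eq fC
  have h2 : (f x : ℂ) = 𝓕⁻ (𝓕 fC : 𝓢(V3, ℂ)) x := by
    rw [h1]; rfl
  rw [h2, SchwartzMap.fourierInv_coe, Real.fourierInv_eq']
  let G : V3 → ℂ := fun v => Complex.exp (((2 * Real.pi * ⟪v, x⟫ : ℝ) : ℂ) * Complex.I) • (𝓕 fC) v
  have h3 : ∀ k : V3, Complex.exp (Complex.I * (⟪k, x⟫ : ℂ)) * ft (fun x => (f x : ℂ)) k =
      (((2 * Real.pi) ^ (-(3 : ℝ) / 2) : ℝ) : ℂ) * G ((2 * Real.pi)⁻¹ • k) := by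
    intro k
    rw [ft_fourier]
    simp only [G, smul_eq_mul, real_inner_smul_left]
    have : ((2 * Real.pi * ((2 * Real.pi)⁻¹ * ⟪k, x⟫) : ℝ) : ℂ) * Complex.I = Complex.I * (⟪k, x⟫ : ℂ) := by
      have hpi : (Real.pi : ℂ) ≠ 0 := by exact_mod_cast Real.pi_ne_zero
      push_cast
      field_simp
    rw [this]
    ring
  simp_rw [h3]
  rw [integral_const_mul, Measure.integral_comp_smul]
  have h4 : Module.finrank ℝ V3 = 3 := by simp
  rw [h4, Complex.real_smul, ← mul_assoc, ← mul_assoc]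
  have h5 : (2 * Real.pi) ^ (-(3 : ℝ) / 2) * (2 * Real.pi) ^ (-(3 : ℝ) / 2) * |(((2 * Real.pi)⁻¹) ^ 3)⁻¹| = 1 := by
    rw [← Real.rpow_add (by positivity), abs_of_pos (by positivity), inv_pow, inv_inv,
      ← Real.rpow_natCast, ← Real.rpow_add (by positivity)]
    norm_num
  have h6 : (((2 * Real.pi) ^ (-(3 : ℝ) / 2) : ℝ) : ℂ) * (((2 * Real.pi) ^ (-(3 : ℝ) / 2) : ℝ) : ℂ) * ((|(((2 * Real.pi)⁻¹) ^ 3)⁻¹| : ℝ) : ℂ) = 1 := by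
    exact_mod_cast h5
  rw [h6, one_mul]

/-- plane wave -/
def pw (x k : V3) : ℂ := Complex.exp (Complex.I * (⟪k, x⟫ : ℂ))

lemma pw_norm (x k : V3) : ‖pw x k‖ = 1 := by
  unfold pw
  rw [mul_comm, Complex.norm_exp_ofReal_mul_I]

lemma pw_cont (x : V3) : Continuous (pw x) := by
  unfold pw
  fun_prop

lemma pw_deriv (x e k : V3) (s : ℝ) :
    HasDerivAt (fun s : ℝ => pw (x + s • e) k) (pw (x + s • e) k * (Complex.I * (⟪k, e⟫ : ℂ))) s := by
  have h : HasDerivAt (fun s : ℝ => Complex.I * ((⟪k, x⟫ + s * ⟪k, e⟫ : ℝ) : ℂ)) (Complex.I * (⟪k, e⟫ : ℂ)) s := by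
    have h0 : HasDerivAt (fun s : ℝ => ⟪k, x⟫ + s * ⟪k, e⟫) ⟪k, e⟫ s := by
      have := ((hasDerivAt_id s).mul_const ⟪k, e⟫).const_add ⟪k, x⟫
      simpa using this
    exact (h0.ofReal_comp).const_mul Complex.I
  have h2 := h.cexp
  have e1 : ∀ s : ℝ, pw (x + s • e) k = Complex.exp (Complex.I * ((⟪k, x⟫ + s * ⟪k, e⟫ : ℝ) : ℂ)) := by
    intro s
    simp only [pw, inner_add_right, real_inner_smul_right]
  simp only [e1]
  exact h2

lemma pw_mul_int {G : V3 → ℂ} (hG : Integrable G) (x : V3) : Integrable (fun k => pw x k * G k) := by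
  refine hG.bdd_mul (c := 1) (pw_cont x).aestronglyMeasurable (Eventually.of_forall fun k => (pw_norm x k).le)

lemma space_deriv {G : V3 → ℂ} (hG : Integrable G) (hG1 : Integrable (fun k : V3 => ‖k‖ * ‖G k‖))
    (x e : V3) (he : ‖e‖ = 1) (s : ℝ) :
    HasDerivAt (fun s : ℝ => ∫ k, pw (x + s • e) k * G k)
      (∫ k, pw (x + s • e) k * ((Complex.I * (⟪k, e⟫ : ℂ)) * G k)) s := by
  refine (hasDerivAt_integral_of_dominated_loc_of_deriv_le (s := Set.univ) (bound := fun k : V3 => ‖k‖ * ‖G k‖)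
    (F' := fun s k => pw (x + s • e) k * ((Complex.I * (⟪k, e⟫ : ℂ)) * G k))
    univ_mem (Eventually.of_forall fun s => (pw_mul_int hG _).aestronglyMeasurable) (pw_mul_int hG _) ?_ ?_ hG1 ?_).2
  · refine (pw_cont _).aestronglyMeasurable.mul (AEStronglyMeasurable.mul ?_ hG.aestronglyMeasurable)
    exact Continuous.aestronglyMeasurable (by fun_prop)
  · refine Eventually.of_forall fun k s _ => ?_
    rw [norm_mul, pw_norm, one_mul, norm_mul, norm_mul, Complex.norm_I, one_mul, Complex.norm_real]
    have := norm_inner_le_norm (𝕜 := ℝ) k e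
    rw [he, mul_one] at this
    gcongr
  · refine Eventually.of_forall fun k s _ => ?_
    have := (pw_deriv x e k s).mul_const (G k)
    refine this.congr_deriv ?_
    ring

lemma space_deriv2 {G : V3 → ℂ} (hG : Integrable G) (hG1 : Integrable (fun k : V3 => ‖k‖ ^ 2 * ‖G k‖))
    (x e : V3) (he : ‖e‖ = 1) :
    iteratedDeriv 2 (fun s : ℝ => ∫ k, pw (x + s • e) k * G k) 0 =
      ∫ k, -((⟪k, e⟫ : ℂ) ^ 2) * (pw x k * G k) := by
  have hk1 : Integrable (fun k : V3 => ‖k‖ * ‖G k‖) := by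
    refine (hG.norm.add hG1).mono' ?_ (Eventually.of_forall fun k => ?_)
    · exact continuous_norm.aestronglyMeasurable.mul hG.aestronglyMeasurable.norm
    · rw [Real.norm_of_nonneg (by positivity)]
      have h1 : ‖k‖ ≤ 1 + ‖k‖ ^ 2 := by nlinarith [sq_nonneg (‖k‖ - 1)]
      calc ‖k‖ * ‖G k‖ ≤ (1 + ‖k‖ ^ 2) * ‖G k‖ := by gcongr
        _ = _ := by simp; ring
  have hin : ∀ k : V3, ‖(⟪k, e⟫ : ℂ)‖ ≤ ‖k‖ := by
    intro k
    have := norm_inner_le_norm (𝕜 := ℝ) k e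
    rw [he, mul_one] at this
    rwa [Complex.norm_real]
  set G1 : V3 → ℂ := fun k => (Complex.I * (⟪k, e⟫ : ℂ)) * G k with hG1d
  have hm : AEStronglyMeasurable G1 := by
    refine AEStronglyMeasurable.mul ?_ hG.aestronglyMeasurable
    exact Continuous.aestronglyMeasurable (by fun_prop)
  have hn : ∀ k, ‖G1 k‖ ≤ ‖k‖ * ‖G k‖ := by
    intro k
    simp only [hG1d]
    rw [norm_mul, norm_mul, Complex.norm_I, one_mul]
    gcongr
    exact hin k
  have i1 : Integrable G1 := hk1.mono' hm (Eventually.of_forall hn)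
  have i2 : Integrable (fun k : V3 => ‖k‖ * ‖G1 k‖) := by
    refine hG1.mono' (continuous_norm.aestronglyMeasurable.mul hm.norm) (Eventually.of_forall fun k => ?_)
    rw [Real.norm_of_nonneg (by positivity)]
    calc ‖k‖ * ‖G1 k‖ ≤ ‖k‖ * (‖k‖ * ‖G k‖) := by gcongr; exact hn k
      _ = _ := by ring
  have d1 : deriv (fun s : ℝ => ∫ k, pw (x + s • e) k * G k) = fun s => ∫ k, pw (x + s • e) k * G1 k := by
    funext s
    exact (space_deriv hG hk1 x e he s).deriv
  have d2 := (space_deriv i1 i2 x e he 0).deriv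
  rw [iteratedDeriv_succ, iteratedDeriv_one, d1, d2]
  refine integral_congr_ae (Eventually.of_forall fun k => ?_)
  simp only [hG1d, zero_smul, add_zero]
  linear_combination (pw x k * (⟪k, e⟫ : ℂ) ^ 2 * G k) * Complex.I_mul_I
end

section
open Complex MeasureTheory Filter
open scoped RealInnerProductSpace FourierTransform SchwartzMap

/-- A family of mode amplitudes solving the mode equation with controlled data at `t₀`. -/
structure Amp (M t₀ : ℝ) (A A1 A2 : ℝ → V3 → ℂ) (p : V3 → ℝ) : Prop where
  hM : 0 ≤ M
  ht₀ : 0 < t₀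
  d0 : ∀ t, 0 < t → ∀ k : V3, k ≠ 0 → HasDerivAt (fun s => A s k) (A1 t k) t
  d1 : ∀ t, 0 < t → ∀ k : V3, k ≠ 0 → HasDerivAt (fun s => A1 s k) (A2 t k) t
  ode : ∀ t : ℝ, 0 < t → ∀ k : V3, k ≠ 0 →
    (t : ℂ) ^ 2 * (A2 t k + (‖k‖ : ℂ) ^ 2 * A t k) - 2 * t * A1 t k + M * A t k = 0
  m0 : ∀ t, 0 < t → AEStronglyMeasurable (A t)
  m1 : ∀ t, 0 < t → AEStronglyMeasurable (A1 t)
  p0 : ∀ k, 0 ≤ p k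
  hp : ∀ k : V3, k ≠ 0 → ‖A1 t₀ k‖ ^ 2 + (1 + ‖k‖ ^ 2) * ‖A t₀ k‖ ^ 2 ≤ p k ^ 2
  pint : Integrable (fun k : V3 => (1 + ‖k‖ ^ 2) * p k)

lemma ae_ne_zero : ∀ᵐ k : V3, k ≠ 0 := by
  have : (volume : Measure V3) {0} = 0 := measure_singleton 0
  exact compl_mem_ae_iff.mpr this

namespace Amp
variable {M t₀ : ℝ} {A A1 A2 : ℝ → V3 → ℂ} {p : V3 → ℝ}

lemma a2_eq (h : Amp M t₀ A A1 A2 p) {t : ℝ} (ht : 0 < t) {k : V3} (hk : k ≠ 0) :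
    A2 t k = (2 / t : ℂ) * A1 t k - ((‖k‖ : ℂ) ^ 2 + M / t ^ 2) * A t k := by
  have ht' : (t : ℂ) ≠ 0 := by exact_mod_cast ht.ne'
  have := h.ode t ht k hk
  field_simp
  linear_combination this

lemma m2 (h : Amp M t₀ A A1 A2 p) {t : ℝ} (ht : 0 < t) : AEStronglyMeasurable (A2 t) := by
  have : AEStronglyMeasurable (fun k : V3 => (2 / t : ℂ) * A1 t k - ((‖k‖ : ℂ) ^ 2 + M / t ^ 2) * A t k) := by
    refine ((h.m1 t ht).const_mul _).sub (AEStronglyMeasurable.mul ?_ (h.m0 t ht))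
    exact Continuous.aestronglyMeasurable (by fun_prop)
  refine this.congr ?_
  filter_upwards [ae_ne_zero] with k hk
  exact (h.a2_eq ht hk).symm

lemma bounds (h : Amp M t₀ A A1 A2 p) {t : ℝ} (ht : 0 < t) :
    ∃ K : ℝ, ∃ U ∈ nhds t, (∀ s ∈ U, 0 < s) ∧ ∀ s ∈ U, ∀ k : V3, k ≠ 0 →
      ‖A s k‖ ≤ K * ((1 + ‖k‖ ^ 2) * p k) ∧ ‖A1 s k‖ ≤ K * ((1 + ‖k‖ ^ 2) * p k) ∧
      ‖A2 s k‖ ≤ K * ((1 + ‖k‖ ^ 2) * p k) ∧ ‖k‖ ^ 2 * ‖A s k‖ ≤ K * ((1 + ‖k‖ ^ 2) * p k) := by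
  set a := min t t₀ / 2 with ha
  set b := max t t₀ + 1 with hb
  have ht₀ := h.ht₀
  have hM := h.hM
  have hmin : 0 < min t t₀ := lt_min ht ht₀
  have ha0 : 0 < a := by positivity
  have h1 : a < t := by linarith [min_le_left t t₀]
  have h2 : t < b := by linarith [le_max_left t t₀]
  have h3 : t₀ ∈ Set.Icc a b := ⟨by linarith [min_le_right t t₀], by linarith [le_max_right t t₀]⟩
  set L := Real.exp ((4 / a + 1 + M / a ^ 2) * (b - a)) with hL
  set q := Real.sqrt L with hq
  have hq0 : 0 ≤ q := Real.sqrt_nonneg _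
  have hqL : q ^ 2 = L := Real.sq_sqrt (Real.exp_pos _).le
  refine ⟨(1 + 2 / a + M / a ^ 2) * q, Set.Icc a b, Icc_mem_nhds h1 h2, fun s hs => ha0.trans_le hs.1, ?_⟩
  intro s hs k hk
  have hs0 : 0 < s := ha0.trans_le hs.1
  have hE := energy_bound (y := fun s => A s k) (y1 := fun s => A1 s k) (y2 := fun s => A2 s k)
    (κ := ‖k‖) (M := M) ha0 hM (fun s hs => h.d0 s hs k hk) (fun s hs => h.d1 s hs k hk)
    (fun s hs => h.ode s hs k hk) h3 hs
  have hp := h.hp k hk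
  have hp0 := h.p0 k
  have hE2 : ‖A1 s k‖ ^ 2 + (1 + ‖k‖ ^ 2) * ‖A s k‖ ^ 2 ≤ (q * p k) ^ 2 := by
    rw [mul_pow, hqL]
    exact hE.trans (mul_le_mul_of_nonneg_left hp (Real.exp_pos _).le)
  have hA1 : ‖A1 s k‖ ≤ q * p k := by
    refine (sq_le_sq₀ (norm_nonneg _) (by positivity)).mp ?_
    have : 0 ≤ (1 + ‖k‖ ^ 2) * ‖A s k‖ ^ 2 := by positivity
    linarith
  have hA : ‖A s k‖ ≤ q * p k := by
    refine (sq_le_sq₀ (norm_nonneg _) (by positivity)).mp ?_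
    have : 0 ≤ (‖k‖ ^ 2) * ‖A s k‖ ^ 2 := by positivity
    nlinarith [sq_nonneg ‖A1 s k‖]
  have hD : 1 ≤ 1 + 2 / a + M / a ^ 2 := by
    have : 0 ≤ 2 / a + M / a ^ 2 := by positivity
    linarith
  have hk1 : 1 ≤ 1 + ‖k‖ ^ 2 := by nlinarith [sq_nonneg ‖k‖]
  have hk2 : ‖k‖ ^ 2 ≤ 1 + ‖k‖ ^ 2 := by linarith
  have hqp : 0 ≤ q * p k := by positivity
  have hw1 : q * p k ≤ (1 + 2 / a + M / a ^ 2) * q * ((1 + ‖k‖ ^ 2) * p k) := by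
    calc q * p k = 1 * 1 * (q * p k) := by ring
      _ ≤ (1 + 2 / a + M / a ^ 2) * (1 + ‖k‖ ^ 2) * (q * p k) := by gcongr
      _ = _ := by ring
  refine ⟨hA.trans hw1, hA1.trans hw1, ?_, ?_⟩
  · rw [h.a2_eq hs0 hk]
    have e1 : ‖(2 / s : ℂ)‖ = 2 / s := by
      rw [norm_div, Complex.norm_ofNat, Complex.norm_real, Real.norm_of_nonneg hs0.le]
    have e2 : ‖((‖k‖ : ℂ) ^ 2 + M / s ^ 2)‖ = ‖k‖ ^ 2 + M / s ^ 2 := by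
      have : ((‖k‖ : ℂ) ^ 2 + M / s ^ 2) = ((‖k‖ ^ 2 + M / s ^ 2 : ℝ) : ℂ) := by push_cast; ring
      rw [this, Complex.norm_real, Real.norm_of_nonneg (by positivity)]
    have hs1 : 2 / s ≤ 2 / a := by
      have := hs.1
      gcongr
    have hs2 : M / s ^ 2 ≤ M / a ^ 2 := by
      have := hs.1
      gcongr
    calc ‖(2 / s : ℂ) * A1 s k - ((‖k‖ : ℂ) ^ 2 + M / s ^ 2) * A s k‖
        ≤ ‖(2 / s : ℂ) * A1 s k‖ + ‖((‖k‖ : ℂ) ^ 2 + M / s ^ 2) * A s k‖ := norm_sub_le _ _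
      _ = 2 / s * ‖A1 s k‖ + (‖k‖ ^ 2 + M / s ^ 2) * ‖A s k‖ := by rw [norm_mul, norm_mul, e1, e2]
      _ ≤ 2 / a * (q * p k) + (‖k‖ ^ 2 + M / a ^ 2) * (q * p k) := by gcongr
      _ ≤ 2 / a * (1 + ‖k‖ ^ 2) * (q * p k) + ((1 + ‖k‖ ^ 2) + M / a ^ 2 * (1 + ‖k‖ ^ 2)) * (q * p k) := by
          have g1 : 2 / a ≤ 2 / a * (1 + ‖k‖ ^ 2) := le_mul_of_one_le_right (by positivity) hk1
          have g2 : M / a ^ 2 ≤ M / a ^ 2 * (1 + ‖k‖ ^ 2) := le_mul_of_one_le_right (by positivity) hk1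
          gcongr
      _ = _ := by ring
  · calc ‖k‖ ^ 2 * ‖A s k‖ ≤ (1 + ‖k‖ ^ 2) * (q * p k) := by gcongr
      _ = 1 * ((1 + ‖k‖ ^ 2) * (q * p k)) := by ring
      _ ≤ (1 + 2 / a + M / a ^ 2) * ((1 + ‖k‖ ^ 2) * (q * p k)) := by gcongr
      _ = _ := by ring

lemma int0 (h : Amp M t₀ A A1 A2 p) {t : ℝ} (ht : 0 < t) : Integrable (A t) := by
  obtain ⟨K, U, hU, -, hb⟩ := h.bounds ht
  refine (h.pint.const_mul K).mono' (h.m0 t ht) ?_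
  filter_upwards [ae_ne_zero] with k hk
  exact (hb t (mem_of_mem_nhds hU) k hk).1

lemma int1 (h : Amp M t₀ A A1 A2 p) {t : ℝ} (ht : 0 < t) : Integrable (A1 t) := by
  obtain ⟨K, U, hU, -, hb⟩ := h.bounds ht
  refine (h.pint.const_mul K).mono' (h.m1 t ht) ?_
  filter_upwards [ae_ne_zero] with k hk
  exact (hb t (mem_of_mem_nhds hU) k hk).2.1

lemma int2 (h : Amp M t₀ A A1 A2 p) {t : ℝ} (ht : 0 < t) : Integrable (A2 t) := by
  obtain ⟨K, U, hU, -, hb⟩ := h.bounds ht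
  refine (h.pint.const_mul K).mono' (h.m2 ht) ?_
  filter_upwards [ae_ne_zero] with k hk
  exact (hb t (mem_of_mem_nhds hU) k hk).2.2.1

lemma intk (h : Amp M t₀ A A1 A2 p) {t : ℝ} (ht : 0 < t) :
    Integrable (fun k : V3 => ‖k‖ ^ 2 * ‖A t k‖) := by
  obtain ⟨K, U, hU, -, hb⟩ := h.bounds ht
  refine (h.pint.const_mul K).mono'
    ((Continuous.aestronglyMeasurable (by fun_prop)).mul (h.m0 t ht).norm) ?_
  filter_upwards [ae_ne_zero] with k hk
  rw [Real.norm_of_nonneg (by positivity)]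
  exact (hb t (mem_of_mem_nhds hU) k hk).2.2.2

lemma time_deriv (h : Amp M t₀ A A1 A2 p) {t : ℝ} (ht : 0 < t) (x : V3) :
    HasDerivAt (fun s => ∫ k, pw x k * A s k) (∫ k, pw x k * A1 t k) t := by
  obtain ⟨K, U, hU, hUp, hb⟩ := h.bounds ht
  refine (hasDerivAt_integral_of_dominated_loc_of_deriv_le (s := U)
    (bound := fun k => K * ((1 + ‖k‖ ^ 2) * p k))
    (F' := fun s k => pw x k * A1 s k) hU ?_ (pw_mul_int (h.int0 ht) x)
    (pw_mul_int (h.int1 ht) x).aestronglyMeasurable ?_ (h.pint.const_mul K) ?_).2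
  · filter_upwards [lt_mem_nhds ht] with s hs
    exact (pw_mul_int (h.int0 hs) x).aestronglyMeasurable
  · filter_upwards [ae_ne_zero] with k hk s hs
    rw [norm_mul, pw_norm, one_mul]
    exact (hb s hs k hk).2.1
  · filter_upwards [ae_ne_zero] with k hk s hs
    exact (h.d0 s (hUp s hs) k hk).const_mul _

lemma time_deriv2 (h : Amp M t₀ A A1 A2 p) {t : ℝ} (ht : 0 < t) (x : V3) :
    HasDerivAt (fun s => ∫ k, pw x k * A1 s k) (∫ k, pw x k * A2 t k) t := by
  obtain ⟨K, U, hU, hUp, hb⟩ := h.bounds ht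
  refine (hasDerivAt_integral_of_dominated_loc_of_deriv_le (s := U)
    (bound := fun k => K * ((1 + ‖k‖ ^ 2) * p k))
    (F' := fun s k => pw x k * A2 s k) hU ?_ (pw_mul_int (h.int1 ht) x)
    (pw_mul_int (h.int2 ht) x).aestronglyMeasurable ?_ (h.pint.const_mul K) ?_).2
  · filter_upwards [lt_mem_nhds ht] with s hs
    exact (pw_mul_int (h.int1 hs) x).aestronglyMeasurable
  · filter_upwards [ae_ne_zero] with k hk s hs
    rw [norm_mul, pw_norm, one_mul]
    exact (hb s hs k hk).2.2.1
  · filter_upwards [ae_ne_zero] with k hk s hs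
    exact (h.d1 s (hUp s hs) k hk).const_mul _

lemma iter2 (h : Amp M t₀ A A1 A2 p) {t : ℝ} (ht : 0 < t) (x : V3) (c : ℂ) :
    iteratedDeriv 2 (fun s => c * ∫ k, pw x k * A s k) t = c * ∫ k, pw x k * A2 t k := by
  rw [iteratedDeriv_succ, iteratedDeriv_one]
  have : deriv (fun s => c * ∫ k, pw x k * A s k) =ᶠ[nhds t] fun s => c * ∫ k, pw x k * A1 s k := by
    filter_upwards [lt_mem_nhds ht] with s hs
    exact ((h.time_deriv hs x).const_mul c).deriv
  rw [this.deriv_eq]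
  exact ((h.time_deriv2 ht x).const_mul c).deriv

lemma lap (h : Amp M t₀ A A1 A2 p) {t : ℝ} (ht : 0 < t) (x : V3) (c : ℂ) :
    lap3 (fun y => c * ∫ k, pw y k * A t k) x = -(c * ∫ k, (‖k‖ : ℂ) ^ 2 * (pw x k * A t k)) := by
  unfold lap3
  have hone : ∀ i : Fin 3, ‖(EuclideanSpace.single i (1 : ℝ) : V3)‖ = 1 := by
    intro i; simp
  have h1 : ∀ i : Fin 3, iteratedDeriv 2 (fun s : ℝ =>
      c * ∫ k, pw (x + s • EuclideanSpace.single i (1 : ℝ)) k * A t k) 0 =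
      c * ∫ k : V3, -((k i : ℂ) ^ 2) * (pw x k * A t k) := by
    intro i
    have := space_deriv2 (h.int0 ht) (h.intk ht) x (EuclideanSpace.single i (1 : ℝ)) (hone i)
    rw [iteratedDeriv_const_mul_field, this]
    congr 1
    refine integral_congr_ae (Eventually.of_forall fun k => ?_)
    simp [EuclideanSpace.inner_single_right]
  rw [Finset.sum_congr rfl (fun i _ => h1 i), ← Finset.mul_sum, ← integral_finsetSum]
  · rw [← mul_neg, ← integral_neg]
    congr 1
    refine integral_congr_ae (Eventually.of_forall fun k => ?_)
    simp only
    rw [← Finset.sum_mul, Finset.sum_neg_distrib]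
    have : ((‖k‖ : ℂ)) ^ 2 = ∑ i : Fin 3, (k i : ℂ) ^ 2 := by
      have := EuclideanSpace.real_norm_sq_eq k
      exact_mod_cast this
    rw [this]; ring
  · intro i _
    refine (h.intk ht).mono' ?_ (Eventually.of_forall fun k => ?_)
    · refine AEStronglyMeasurable.mul ?_ (pw_mul_int (h.int0 ht) x).aestronglyMeasurable
      exact Continuous.aestronglyMeasurable (by fun_prop)
    · rw [norm_mul, norm_mul, pw_norm, one_mul, norm_neg, norm_pow, Complex.norm_real]
      have := PiLp.norm_apply_le k i
      gcongr

lemma pde (h : Amp M t₀ A A1 A2 p) {t : ℝ} (ht : 0 < t) (x : V3) (c : ℂ) :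
    (t : ℂ) ^ 2 * (iteratedDeriv 2 (fun s => c * ∫ k, pw x k * A s k) t -
      lap3 (fun y => c * ∫ k, pw y k * A t k) x) -
      2 * t * deriv (fun s => c * ∫ k, pw x k * A s k) t +
      M * (c * ∫ k, pw x k * A t k) = 0 := by
  rw [h.iter2 ht, h.lap ht, ((h.time_deriv ht x).const_mul c).deriv]
  have i0 := pw_mul_int (h.int0 ht) x
  have i1 := pw_mul_int (h.int1 ht) x
  have i2 := pw_mul_int (h.int2 ht) x
  have ik : Integrable (fun k : V3 => (‖k‖ : ℂ) ^ 2 * (pw x k * A t k)) := by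
    refine (h.intk ht).mono' ?_ (Eventually.of_forall fun k => ?_)
    · refine AEStronglyMeasurable.mul ?_ i0.aestronglyMeasurable
      exact Continuous.aestronglyMeasurable (by fun_prop)
    · rw [norm_mul, norm_mul, pw_norm, one_mul, norm_pow, Complex.norm_real, norm_norm]
  have key : (∫ k : V3, ((t : ℂ) ^ 2 * (pw x k * A2 t k + (‖k‖ : ℂ) ^ 2 * (pw x k * A t k)) -
      2 * t * (pw x k * A1 t k) + M * (pw x k * A t k))) = 0 := by
    rw [← integral_zero V3 ℂ]
    refine integral_congr_ae ?_
    filter_upwards [ae_ne_zero] with k hk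
    linear_combination pw x k * h.ode t ht k hk
  have j2 : Integrable (fun k : V3 => (t : ℂ) ^ 2 * (pw x k * A2 t k + (‖k‖ : ℂ) ^ 2 * (pw x k * A t k))) :=
    (i2.add ik).const_mul _
  have j1 : Integrable (fun k : V3 => 2 * (t : ℂ) * (pw x k * A1 t k)) := i1.const_mul _
  have j0 : Integrable (fun k : V3 => (M : ℂ) * (pw x k * A t k)) := i0.const_mul _
  have j3 : Integrable (fun k : V3 => (t : ℂ) ^ 2 * (pw x k * A2 t k + (‖k‖ : ℂ) ^ 2 * (pw x k * A t k)) -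
      2 * (t : ℂ) * (pw x k * A1 t k)) := j2.sub j1
  rw [integral_add j3 j0, integral_sub j2 j1, integral_const_mul, integral_const_mul,
    integral_const_mul, integral_add i2 ik] at key
  linear_combination c * key

end Amp
end


def coP (μ R t : ℝ) (F H : V3 → ℂ) (k : V3) : ℂ :=
  ((Real.pi : ℂ) * Complex.I / (4 * (t : ℂ) ^ 3)) *
    ((t : ℂ) * F k * (starRingEnd ℂ) (vv1 μ t ‖k‖) - (R : ℂ) * H k * (starRingEnd ℂ) (vv μ t ‖k‖))

def coQ (μ R t : ℝ) (F H : V3 → ℂ) (k : V3) : ℂ :=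
  -((Real.pi : ℂ) * Complex.I / (4 * (t : ℂ) ^ 3)) *
    ((t : ℂ) * F k * vv1 μ t ‖k‖ - (R : ℂ) * H k * vv μ t ‖k‖)

lemma meas_of_cont {g : V3 → ℂ} (hg : ContinuousOn g {0}ᶜ) : AEStronglyMeasurable g := by
  have h := hg.aestronglyMeasurable (μ := (volume : Measure V3)) (measurableSet_singleton (0 : V3)).compl
  rwa [Measure.restrict_eq_self_of_ae_mem] at h
  exact ae_ne_zero

lemma coP_cont (μ R : ℝ) {t : ℝ} (ht : 0 < t) {F H : V3 → ℂ} (hF : Continuous F) (hH : Continuous H) :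
    ContinuousOn (coP μ R t F H) {0}ᶜ := by
  have c0 : ContinuousOn (fun k : V3 => (starRingEnd ℂ) (vv μ t ‖k‖)) {0}ᶜ :=
    Complex.continuous_conj.comp_continuousOn (vv_cont μ ht)
  have c1 : ContinuousOn (fun k : V3 => (starRingEnd ℂ) (vv1 μ t ‖k‖)) {0}ᶜ :=
    Complex.continuous_conj.comp_continuousOn (vv1_cont μ ht)
  exact continuousOn_const.mul (((continuousOn_const.mul hF.continuousOn).mul c1).sub
    ((continuousOn_const.mul hH.continuousOn).mul c0))

lemma coQ_cont (μ R : ℝ) {t : ℝ} (ht : 0 < t) {F H : V3 → ℂ} (hF : Continuous F) (hH : Continuous H) :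
    ContinuousOn (coQ μ R t F H) {0}ᶜ :=
  continuousOn_const.mul (((continuousOn_const.mul hF.continuousOn).mul (vv1_cont μ ht)).sub
    ((continuousOn_const.mul hH.continuousOn).mul (vv_cont μ ht)))

lemma schwartz_int (S : SchwartzMap V3 ℂ) :
    Integrable (fun k : V3 => (1 + ‖k‖ ^ 2) * ((1 + ‖k‖) * ‖S k‖)) := by
  have i0 := S.integrable_pow_mul (volume : Measure V3) 0
  have i1 := S.integrable_pow_mul (volume : Measure V3) 1
  have i2 := S.integrable_pow_mul (volume : Measure V3) 2
  have i3 := S.integrable_pow_mul (volume : Measure V3) 3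
  refine (((i0.add i1).add i2).add i3).congr (Eventually.of_forall fun k => ?_)
  simp only [Pi.add_apply]
  ring

lemma amp_main {μ R t₀ : ℝ} (hμ : 0 < μ) (hR : 0 < R) (ht₀ : 0 < t₀) (F H : SchwartzMap V3 ℂ) :
    let P := coP μ R t₀ F H
    let Q := coQ μ R t₀ F H
    let A := fun t (k : V3) => vv μ t ‖k‖ * P k + (starRingEnd ℂ) (vv μ t ‖k‖) * Q k
    let A1 := fun t (k : V3) => vv1 μ t ‖k‖ * P k + (starRingEnd ℂ) (vv1 μ t ‖k‖) * Q k
    (∀ k : V3, k ≠ 0 → A t₀ k = F k) ∧ (∀ k : V3, k ≠ 0 → A1 t₀ k = (R / t₀ : ℂ) * H k) ∧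
    ∃ A2 p, Amp (μ ^ 2 + 9 / 4) t₀ A A1 A2 p := by
  intro P Q A A1
  have ht' : (t₀ : ℂ) ≠ 0 := by exact_mod_cast ht₀.ne'
  have hpi : (Real.pi : ℂ) ≠ 0 := by exact_mod_cast Real.pi_ne_zero
  have hA : ∀ k : V3, k ≠ 0 → A t₀ k = F k := by
    intro k hk
    have hw := vv_wronskian hμ ht₀ (norm_pos_iff.mpr hk)
    have : A t₀ k = ((Real.pi : ℂ) * Complex.I / (4 * (t₀ : ℂ) ^ 3)) * t₀ * F k *
      (vv μ t₀ ‖k‖ * (starRingEnd ℂ) (vv1 μ t₀ ‖k‖) - (starRingEnd ℂ) (vv μ t₀ ‖k‖) * vv1 μ t₀ ‖k‖) := by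
      simp only [A, P, Q, coP, coQ]; ring
    rw [this, hw]
    field_simp
    linear_combination (-F k) * Complex.I_sq
  have hA1 : ∀ k : V3, k ≠ 0 → A1 t₀ k = (R / t₀ : ℂ) * H k := by
    intro k hk
    have hw := vv_wronskian hμ ht₀ (norm_pos_iff.mpr hk)
    have : A1 t₀ k = ((Real.pi : ℂ) * Complex.I / (4 * (t₀ : ℂ) ^ 3)) * R * H k *
      (vv μ t₀ ‖k‖ * (starRingEnd ℂ) (vv1 μ t₀ ‖k‖) - (starRingEnd ℂ) (vv μ t₀ ‖k‖) * vv1 μ t₀ ‖k‖) := by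
      simp only [A1, P, Q, coP, coQ]; ring
    rw [this, hw]
    field_simp
    linear_combination (-(R : ℂ) * H k) * Complex.I_sq
  have conjd : ∀ {g : ℝ → ℂ} {g' : ℂ} {t : ℝ}, HasDerivAt g g' t →
      HasDerivAt (fun s => (starRingEnd ℂ) (g s)) ((starRingEnd ℂ) g') t := by
    intro g g' t hg
    exact hg.star
  refine ⟨hA, hA1, fun t (k : V3) => vv2 μ t ‖k‖ * P k + (starRingEnd ℂ) (vv2 μ t ‖k‖) * Q k,
    fun k => R / t₀ * ‖H k‖ + (1 + ‖k‖) * ‖F k‖, ?_⟩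
  refine ⟨by positivity, ht₀, ?_, ?_, ?_, ?_, ?_, ?_, ?_, ?_⟩
  · intro t ht k hk
    have h := vv_deriv μ ht (norm_pos_iff.mpr hk)
    exact (h.mul_const _).add ((conjd h).mul_const _)
  · intro t ht k hk
    have h := vv1_deriv μ ht (norm_pos_iff.mpr hk)
    exact (h.mul_const _).add ((conjd h).mul_const _)
  · intro t ht k hk
    have h := vv_ode μ ht (norm_pos_iff.mpr hk)
    have hc := congrArg (starRingEnd ℂ) h
    have h2 : (starRingEnd ℂ) 2 = 2 := Complex.conj_ofNat 2
    have h4 : (starRingEnd ℂ) 4 = 4 := Complex.conj_ofNat 4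
    have h9 : (starRingEnd ℂ) 9 = 9 := Complex.conj_ofNat 9
    simp only [map_add, map_sub, map_mul, map_pow, map_div₀, Complex.conj_ofReal, h2, h4, h9, map_zero] at hc
    simp only [A, A1]
    push_cast
    linear_combination P k * h + Q k * hc
  · intro t ht
    refine meas_of_cont (((vv_cont μ ht).mul (coP_cont μ R ht₀ F.continuous H.continuous)).add
      ((Complex.continuous_conj.comp_continuousOn (vv_cont μ ht)).mul
        (coQ_cont μ R ht₀ F.continuous H.continuous)))
  · intro t ht
    refine meas_of_cont (((vv1_cont μ ht).mul (coP_cont μ R ht₀ F.continuous H.continuous)).add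
      ((Complex.continuous_conj.comp_continuousOn (vv1_cont μ ht)).mul
        (coQ_cont μ R ht₀ F.continuous H.continuous)))
  · intro k
    positivity
  · intro k hk
    rw [hA k hk, hA1 k hk]
    have e : ‖(R / t₀ : ℂ) * H k‖ = R / t₀ * ‖H k‖ := by
      rw [norm_mul, norm_div, Complex.norm_real, Complex.norm_real, Real.norm_of_nonneg hR.le,
        Real.norm_of_nonneg ht₀.le]
    rw [e]
    have g1 : 0 ≤ R / t₀ * ‖H k‖ := by positivity
    have g2 : 0 ≤ ‖k‖ * ‖F k‖ ^ 2 := by positivity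
    have g3 : 0 ≤ (R / t₀ * ‖H k‖) * ((1 + ‖k‖) * ‖F k‖) := by positivity
    nlinarith
  · have i1 := schwartz_int F
    have i2 := schwartz_int H
    refine ((i2.const_mul (R / t₀)).add i1).mono' ?_ (Eventually.of_forall fun k => ?_)
    · have c1 := F.continuous
      have c2 := H.continuous
      exact Continuous.aestronglyMeasurable (by fun_prop)
    · rw [Real.norm_of_nonneg (by positivity)]
      simp only [Pi.add_apply]
      have : 0 ≤ R / t₀ * ((1 + ‖k‖ ^ 2) * (‖k‖ * ‖H k‖)) := by positivity
      nlinarith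

/-- `u` solves the de Sitter Klein–Gordon equation
`(t²/R²)(∂²u/∂t² − Δu) − (2t/R²)∂u/∂t + m²u = 0` on `(0,∞)×ℝ³`
and attains the Cauchy data `u(t₀,·) = f`, `(t₀/R)·∂u/∂t(t₀,·) = h`. -/
theorem solution_solves_KG_with_data (m R : ℝ) (hm : 0 < m) (hR : 0 < R)
    (hmR : 3 / 2 < m * R) (f h : SchwartzMap V3 ℝ) (t₀ : ℝ) (ht₀ : 0 < t₀) :
    (∀ t : ℝ, 0 < t → ∀ x : V3,
      ((t ^ 2 / R ^ 2 : ℝ) : ℂ) *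
          (iteratedDeriv 2 (fun s => uSol m R (ktFun m R t₀ ⇑f ⇑h) s x) t -
            lap3 (fun y => uSol m R (ktFun m R t₀ ⇑f ⇑h) t y) x) -
        ((2 * t / R ^ 2 : ℝ) : ℂ) * deriv (fun s => uSol m R (ktFun m R t₀ ⇑f ⇑h) s x) t +
        ((m ^ 2 : ℝ) : ℂ) * uSol m R (ktFun m R t₀ ⇑f ⇑h) t x = 0) ∧
    (∀ x : V3, uSol m R (ktFun m R t₀ ⇑f ⇑h) t₀ x = (f x : ℂ)) ∧
    (∀ x : V3,
      ((t₀ / R : ℝ) : ℂ) * deriv (fun s => uSol m R (ktFun m R t₀ ⇑f ⇑h) s x) t₀ = (h x : ℂ)) := by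
  obtain ⟨F, hF⟩ := ft_schwartz f
  obtain ⟨H, hH⟩ := ft_schwartz h
  set μ := modeMu m R with hμd
  have hsq : 0 < (m * R) ^ 2 - 9 / 4 := by nlinarith
  have hμ : 0 < μ := Real.sqrt_pos.mpr hsq
  have hμ2 : μ ^ 2 + 9 / 4 = (m * R) ^ 2 := by
    rw [hμd, modeMu, Real.sq_sqrt hsq.le]; ring
  obtain ⟨hA, hA1, A2, p, amp⟩ := amp_main hμ hR ht₀ F H
  set P := coP μ R t₀ F H with hP
  set Q := coQ μ R t₀ F H with hQ
  set A := fun t (k : V3) => vv μ t ‖k‖ * P k + (starRingEnd ℂ) (vv μ t ‖k‖) * Q k with hAd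
  set A1 := fun t (k : V3) => vv1 μ t ‖k‖ * P k + (starRingEnd ℂ) (vv1 μ t ‖k‖) * Q k with hA1d
  set c : ℂ := (((2 * Real.pi) ^ (-(3 : ℝ) / 2) : ℝ) : ℂ) with hc
  have hψ : ∀ k : V3, k ≠ 0 → ktFun m R t₀ ⇑f ⇑h k = P k := by
    intro k hk
    simp only [ktFun, ktAux, hP, coP]
    rw [modeV'_eq m R ht₀ (norm_pos_iff.mpr hk), modeV_eq, hF, hH]
  have hψ' : ∀ k : V3, k ≠ 0 → (starRingEnd ℂ) (ktFun m R t₀ ⇑f ⇑h (-k)) = Q k := by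
    intro k hk
    have h4 : (starRingEnd ℂ) 4 = 4 := Complex.conj_ofNat 4
    simp only [ktFun, ktAux, hQ, coQ, norm_neg]
    rw [modeV'_eq m R ht₀ (norm_pos_iff.mpr hk), modeV_eq]
    simp only [map_mul, map_sub, map_div₀, map_pow, Complex.conj_ofReal, Complex.conj_conj, Complex.conj_I,
      ft_conj, h4]
    rw [hF, hH]
    ring
  have hu : ∀ (s : ℝ) (x : V3), uSol m R (ktFun m R t₀ ⇑f ⇑h) s x = c * ∫ k, pw x k * A s k := by
    intro s x
    unfold uSol
    congr 1
    refine integral_congr_ae ?_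
    filter_upwards [ae_ne_zero] with k hk
    rw [hψ k hk, hψ' k hk, modeV_eq]
    rfl
  simp only [hu]
  have hd0 : ∀ x, HasDerivAt (fun s => c * ∫ k, pw x k * A s k) (c * ∫ k, pw x k * A1 t₀ k) t₀ :=
    fun x => (amp.time_deriv ht₀ x).const_mul c
  have hRc : (R : ℂ) ≠ 0 := by exact_mod_cast hR.ne'
  have htc : (t₀ : ℂ) ≠ 0 := by exact_mod_cast ht₀.ne'
  refine ⟨fun t ht x => ?_, fun x => ?_, fun x => ?_⟩
  · have key := amp.pde ht x c
    rw [hμ2] at key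
    push_cast at key ⊢
    field_simp
    linear_combination key
  · rw [← ft_inv f x]
    congr 1
    refine integral_congr_ae ?_
    filter_upwards [ae_ne_zero] with k hk
    rw [hA k hk, hF]
    rfl
  · rw [(hd0 x).deriv, ← ft_inv h x]
    have e : ∫ k, pw x k * A1 t₀ k = (R / t₀ : ℂ) *
        ∫ k : V3, Complex.exp (Complex.I * (⟪k, x⟫ : ℂ)) * ft (fun x => (h x : ℂ)) k := by
      rw [← integral_const_mul]
      refine integral_congr_ae ?_
      filter_upwards [ae_ne_zero] with k hk
      rw [hA1 k hk, hH]
      simp only [pw]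
      ring
    rw [e, ← hc]
    generalize (∫ k : V3, Complex.exp (Complex.I * (⟪k, x⟫ : ℂ)) * ft (fun x => (h x : ℂ)) k) = J
    clear_value c
    push_cast
    field_simp
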